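/- arXiv:2308.06569 — 3 statements merged into one kernel-verified Lean document; each statement's English description precedes it below -/
import Mathlib

section
/- (Global-in-time quintic multilinear estimate for the second nonlocal nonlinearity, established in the proof of Lemma 2.5.) For every s > 0 there exists ε₀ ∈ (0, 1/2) such that for every ε ∈ (0, ε₀) there is a constant C = C(s, ε) > 0 with the following property: for all w₁, w₂ ∈ L¹(Λ; ℝ) and all smooth functions v₁, …, v₅ : Λ × ℝ → ℂ with compact support in the time variable, the function 𝒩₂(v₁,…,v₅)(x,t) := ∫_Λ ∫_Λ w₁(x−y) w₂(y−z) v₁(y,t) conj(v₂(y,t)) v₃(z,t) conj(v₄(z,t)) v₅(x,t) dy dz satisfies ‖𝒩₂(v₁,…,v₅)‖_{X^{s,−1/2+ε}} ≤ C ‖w₁‖_{L¹} ‖w₂‖_{L¹} ∏_{j=1}^{5} ‖v_j‖_{X^{s,1/2−ε}}. -/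
open MeasureTheory Complex
open scoped ENNReal

noncomputable section

/-- The spacetime Fourier transform `ṽ(k,η) = ∫_ℝ ∫_Λ v(x,t) e^{−2πikx − 2πiηt} dx dt` of a
function `v : Λ × ℝ → ℂ` on the torus `Λ = ℝ/ℤ` times the real line. -/
def spacetimeFT (v : AddCircle (1:ℝ) → ℝ → ℂ) (k : ℤ) (η : ℝ) : ℂ :=
  ∫ t : ℝ, ∫ x : AddCircle (1:ℝ),
    v x t * fourier (-k) x * Complex.exp (-(2 * Real.pi * η * t) * Complex.I)

/-- The `X^{s,b}` norm
`‖v‖_{X^{s,b}} = ( Σ_{k∈ℤ} ∫_ℝ (1+|2πk|)^{2s} (1+|η+2πk²|)^{2b} |ṽ(k,η)|² dη )^{1/2}`,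
valued in `ℝ≥0∞`. -/
def Xnorm (s b : ℝ) (v : AddCircle (1:ℝ) → ℝ → ℂ) : ℝ≥0∞ :=
  (∑' k : ℤ, ∫⁻ η : ℝ, ENNReal.ofReal
      ((1 + |2 * Real.pi * (k:ℝ)|) ^ (2*s) * (1 + |η + 2 * Real.pi * (k:ℝ)^2|) ^ (2*b) *
        ‖spacetimeFT v k η‖ ^ 2)) ^ ((1:ℝ)/2)

/-- The second nonlocal quintic nonlinearity
`𝒩₂(v₁,…,v₅)(x,t) = ∫∫ w₁(x−y) w₂(y−z) v₁(y,t) conj(v₂(y,t)) v₃(z,t) conj(v₄(z,t)) v₅(x,t) dy dz`. -/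
def N2 (w₁ w₂ : AddCircle (1:ℝ) → ℝ) (v : Fin 5 → AddCircle (1:ℝ) → ℝ → ℂ)
    (x : AddCircle (1:ℝ)) (t : ℝ) : ℂ :=
  ∫ y : AddCircle (1:ℝ), ∫ z : AddCircle (1:ℝ),
    (w₁ (x - y) : ℂ) * (w₂ (y - z) : ℂ) *
      v 0 y t * (starRingEnd ℂ) (v 1 y t) * v 2 z t * (starRingEnd ℂ) (v 3 z t) * v 4 x t

theorem divisor_bound (δ : ℝ) (hδ : 0 < δ) :
    ∃ C : ℝ, 0 < C ∧ ∀ n : ℕ, n ≠ 0 → (n.divisors.card : ℝ) ≤ C * (n:ℝ) ^ δ := by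
  have hl : 0 < Real.log 2 := Real.log_pos (by norm_num)
  set K : ℝ := max 1 (1 / (δ * Real.log 2)) with hK
  have hK1 : 1 ≤ K := le_max_left _ _
  obtain ⟨P, hP⟩ := exists_nat_ge ((2:ℝ) ^ (1/δ))
  refine ⟨K ^ P, by positivity, fun n hn => ?_⟩
  rw [Nat.card_divisors hn]
  push_cast
  have hn' : (n:ℝ) ^ δ = ∏ p ∈ n.primeFactors, ((p:ℝ) ^ (n.factorization p)) ^ δ := by
    rw [Real.finsetProd_rpow _ _ (fun i _ => by positivity)]
    congr 1
    conv_lhs => rw [← Nat.prod_factorization_pow_eq_self hn]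
    simp [Finsupp.prod]
  have key : ∀ p ∈ n.primeFactors, ((n.factorization p : ℝ) + 1) ≤
      (if p < P then K else 1) * ((p:ℝ) ^ (n.factorization p)) ^ δ := by
    intro p hp
    have hp2 : 2 ≤ p := (Nat.prime_of_mem_primeFactors hp).two_le
    have hp2' : (2:ℝ) ≤ p := by exact_mod_cast hp2
    generalize n.factorization p = a
    split_ifs with h
    · have h1 : ((2:ℝ) ^ a) ^ δ ≤ ((p:ℝ) ^ a) ^ δ := by gcongr
      have h2 : 1 + a * δ * Real.log 2 ≤ ((2:ℝ) ^ a) ^ δ := by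
        rw [← Real.rpow_natCast, ← Real.rpow_mul (by norm_num), Real.rpow_def_of_pos (by norm_num)]
        have := Real.add_one_le_exp (Real.log 2 * (a * δ))
        linarith
      have h3 : 1 ≤ K * (δ * Real.log 2) := by
        have : 1 / (δ * Real.log 2) ≤ K := le_max_right _ _
        rwa [div_le_iff₀ (by positivity)] at this
      have ha : (0:ℝ) ≤ a := by positivity
      calc (a:ℝ) + 1 ≤ K * (1 + a * δ * Real.log 2) := by nlinarith
        _ ≤ _ := by gcongr; exact h2.trans h1
    · push Not at h
      have h0 : (2:ℝ) ≤ (p:ℝ) ^ δ := by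
        have : (2:ℝ) ^ (1/δ) ≤ p := hP.trans (by exact_mod_cast h)
        calc (2:ℝ) = ((2:ℝ) ^ (1/δ)) ^ δ := by
              rw [← Real.rpow_mul (by norm_num)]; field_simp; simp
          _ ≤ _ := by gcongr
      rw [one_mul, ← Real.rpow_natCast, ← Real.rpow_mul (by positivity), mul_comm,
        Real.rpow_mul (by positivity), Real.rpow_natCast]
      calc (a:ℝ) + 1 ≤ 2 ^ a := by exact_mod_cast Nat.lt_two_pow_self
        _ ≤ _ := by gcongr
  calc _ ≤ ∏ p ∈ n.primeFactors, (if p < P then K else 1) * ((p:ℝ) ^ (n.factorization p)) ^ δ :=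
        Finset.prod_le_prod (fun i _ => by positivity) key
    _ = (∏ p ∈ n.primeFactors, (if p < P then K else 1)) * (n:ℝ)^δ := by
        rw [Finset.prod_mul_distrib, hn']
    _ ≤ _ := by
        gcongr
        rw [← Finset.prod_filter, Finset.prod_const]
        apply pow_le_pow_right₀ hK1
        calc _ ≤ (Finset.range P).card := Finset.card_le_card (by
              intro x hx; simp at hx; simp [hx.2])
          _ = P := by simp

noncomputable def jb (k : ℤ) : ℝ := 1 + |2 * Real.pi * (k:ℝ)|

theorem jb_ge_one (k : ℤ) : 1 ≤ jb k := by unfold jb; linarith [abs_nonneg (2 * Real.pi * (k:ℝ))]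
theorem jb_ge (k : ℤ) : |(k:ℝ)| + 1 ≤ jb k := by
  unfold jb
  rw [abs_mul, abs_of_pos (by positivity : (0:ℝ) < 2 * Real.pi)]
  nlinarith [abs_nonneg (k:ℝ), Real.pi_gt_three]

theorem arith_sum (s : ℝ) (hs : 0 < s) :
    ∃ C : ℝ≥0∞, C ≠ ∞ ∧ ∀ k m : ℤ, m ≠ 0 →
      ∑' p : ℤ × ℤ, (if (p.1 - k) * (p.2 - k) = m then
        ENNReal.ofReal ((jb p.1 * jb p.2) ^ (-s)) else 0) ≤ C := by
  obtain ⟨C, hC, hdiv⟩ := divisor_bound (s/2) (by positivity)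
  refine ⟨2 + ENNReal.ofReal (2 * C * 9 ^ (s/2)), by finiteness, fun k m hm => ?_⟩
  have hPP : ∀ p : ℤ × ℤ, 1 ≤ jb p.1 * jb p.2 := fun p =>
    one_le_mul_of_one_le_of_one_le (jb_ge_one _) (jb_ge_one _)
  set fS : ℤ × ℤ → ℝ≥0∞ := fun p => if (p.1 - k) * (p.2 - k) = m ∧ 2 * (jb p.1 * jb p.2) < |(k:ℝ)|
    then 1 else 0 with hfS
  set fN : ℤ × ℤ → ℝ≥0∞ := fun p => if (p.1 - k) * (p.2 - k) = m 
    then ENNReal.ofReal (9 ^ (s/2) * (m.natAbs:ℝ)^(-(s/2))) else 0 with hfN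
  have hle : ∀ p : ℤ × ℤ, (if (p.1 - k) * (p.2 - k) = m then
        ENNReal.ofReal ((jb p.1 * jb p.2) ^ (-s)) else 0) ≤ fS p + fN p := by
    intro p
    have h1 := hPP p
    by_cases h : (p.1 - k) * (p.2 - k) = m
    · by_cases h2 : 2 * (jb p.1 * jb p.2) < |(k:ℝ)|
      · simp only [h, hfS, h2, if_true, and_self]
        refine le_trans ?_ le_self_add
        rw [← ENNReal.ofReal_one]
        apply ENNReal.ofReal_le_ofReal
        exact Real.rpow_le_one_of_one_le_of_nonpos h1 (by linarith)
      · simp only [h, hfS, hfN, h2, if_true, and_false, if_false, zero_add]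
        apply ENNReal.ofReal_le_ofReal
        push Not at h2
        set Q := jb p.1 * jb p.2 with hQ
        have hx : |(p.1:ℝ)| ≤ Q := by
          nlinarith [jb_ge p.1, jb_ge_one p.1, jb_ge_one p.2]
        have hy : |(p.2:ℝ)| ≤ Q := by
          nlinarith [jb_ge p.2, jb_ge_one p.1, jb_ge_one p.2]
        have hm9 : (m.natAbs : ℝ) ≤ 9 * Q^2 := by
          rw [Nat.cast_natAbs, ← h]
          push_cast
          rw [abs_mul]
          have a1 : |(p.1:ℝ) - k| ≤ 3 * Q := (abs_sub _ _).trans (by linarith)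
          have a2 : |(p.2:ℝ) - k| ≤ 3 * Q := (abs_sub _ _).trans (by linarith)
          calc _ ≤ (3*Q) * (3*Q) := by gcongr
            _ = _ := by ring
        have hmpos : (0:ℝ) < m.natAbs := by exact_mod_cast Int.natAbs_pos.mpr hm
        clear_value Q
        have : Q ^ (-s) = (9 * Q^2) ^ (-(s/2)) * 9 ^ (s/2) := by
          rw [Real.mul_rpow (by norm_num) (by positivity), ← Real.rpow_natCast Q 2,
            ← Real.rpow_mul (by positivity), mul_comm, ← mul_assoc, ← Real.rpow_add (by norm_num)]
          rw [add_neg_cancel, Real.rpow_zero, one_mul]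
          congr 1
          push_cast; ring
        rw [this, mul_comm]
        gcongr ?_ * ?_
        exact Real.rpow_le_rpow_of_nonpos hmpos hm9 (by linarith)
    · simp [h]
  calc _ ≤ ∑' p, (fS p + fN p) := ENNReal.tsum_le_tsum hle
    _ = ∑' p, fS p + ∑' p, fN p := ENNReal.tsum_add
    _ ≤ _ := by
      gcongr
      · by_cases hex : ∃ p0 : ℤ × ℤ, (p0.1 - k) * (p0.2 - k) = m ∧ 2 * (jb p0.1 * jb p0.2) < |(k:ℝ)|
        · obtain ⟨p0, h0, h0'⟩ := hex
          have hsub : ∀ p ∉ ({p0, (p0.2, p0.1)} : Finset (ℤ × ℤ)), fS p = 0 := by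
            intro p hp
            simp only [hfS, ite_eq_right_iff, one_ne_zero, imp_false]
            rintro ⟨h1, h1'⟩
            apply hp
            have key : k * (p.1 + p.2 - p0.1 - p0.2) = p.1 * p.2 - p0.1 * p0.2 := by
              linear_combination h0 - h1
            have b1 : |(p.1:ℝ) * p.2| ≤ jb p.1 * jb p.2 := by
              rw [abs_mul]
              gcongr <;> linarith [jb_ge p.1, jb_ge p.2, jb_ge_one p.1]
            have b2 : |(p0.1:ℝ) * p0.2| ≤ jb p0.1 * jb p0.2 := by
              rw [abs_mul]
              gcongr <;> linarith [jb_ge p0.1, jb_ge p0.2, jb_ge_one p0.1]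
            have b3 : |(p.1:ℝ) * p.2 - p0.1 * p0.2| < |(k:ℝ)| := by
              refine (abs_sub _ _).trans_lt ?_
              linarith
            have b4 : |p.1 * p.2 - p0.1 * p0.2| < |k| := by exact_mod_cast b3
            have hz : p.1 * p.2 - p0.1 * p0.2 = 0 := 
              Int.eq_zero_of_abs_lt_dvd (m := |k|) (by rw [abs_dvd, ← key]; exact dvd_mul_right _ _) b4
            have hk : k ≠ 0 := by
              rintro rfl
              simp at b4
              linarith [abs_nonneg (p.1 * p.2 - p0.1*p0.2)]
            rw [hz] at key
            have hsum := (mul_eq_zero.mp key).resolve_left hk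
            have hfac : (p.1 - p0.1) * (p.1 - p0.2) = 0 := by
              linear_combination p.1 * hsum - hz
            simp only [Finset.mem_insert, Finset.mem_singleton, Prod.ext_iff]
            rcases mul_eq_zero.mp hfac with h | h
            · left; constructor <;> linarith
            · right; constructor <;> linarith
          rw [tsum_eq_sum hsub]
          calc _ ≤ ∑ p ∈ ({p0, (p0.2, p0.1)} : Finset (ℤ × ℤ)), (1:ℝ≥0∞) := by
                apply Finset.sum_le_sum
                intro i _
                simp only [hfS]; split_ifs <;> simp
            _ ≤ 2 := by
                simp only [Finset.sum_const, nsmul_eq_mul, mul_one]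
                exact_mod_cast Finset.card_le_two
        · push Not at hex
          have : ∀ p, fS p = 0 := by
            intro p
            simp only [hfS, ite_eq_right_iff, one_ne_zero, imp_false]
            rintro ⟨h1, h1'⟩
            exact absurd h1' (not_lt.mpr (hex p h1))
          simp [this]
      · set E : Finset (ℤ × ℤ) := (m.natAbs.divisors ×ˢ ({1,-1} : Finset ℤ)).image
          (fun q => (k + q.2 * q.1, k + m / (q.2 * q.1))) with hE
        have hEc : E.card ≤ 2 * m.natAbs.divisors.card := by
          refine Finset.card_image_le.trans ?_
          rw [Finset.card_product, mul_comm]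
          gcongr
          exact Finset.card_le_two
        have hsub : ∀ p ∉ E, fN p = 0 := by
          intro p hp
          simp only [hfN]
          rw [if_neg]
          intro h
          apply hp
          rw [hE, Finset.mem_image]
          have hne : p.1 - k ≠ 0 := by rintro h'; rw [h'] at h; simp at h; exact hm h.symm
          refine ⟨((p.1-k).natAbs, (p.1-k).sign), ?_, ?_⟩
          · simp only [Finset.mem_product, Nat.mem_divisors, Finset.mem_insert, Finset.mem_singleton]
            refine ⟨⟨Int.natAbs_dvd_natAbs.mpr ⟨_, h.symm⟩, by simpa using hm⟩, ?_⟩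
            rcases lt_or_gt_of_ne hne with h' | h'
            · right; exact Int.sign_eq_neg_one_of_neg h'
            · left; exact Int.sign_eq_one_of_pos h'
          · simp only [Int.sign_mul_natAbs, Prod.ext_iff]
            constructor
            · ring
            · rw [← h, Int.mul_ediv_cancel_left _ hne]; ring
        rw [tsum_eq_sum hsub]
        calc _ ≤ ∑ p ∈ E, ENNReal.ofReal (9 ^ (s/2) * (m.natAbs:ℝ)^(-(s/2))) := by
              apply Finset.sum_le_sum
              intro i _
              simp only [hfN]; split_ifs <;> simp
          _ ≤ _ := by
            rw [Finset.sum_const, nsmul_eq_mul, ← ENNReal.ofReal_natCast, ← ENNReal.ofReal_mul (by positivity)]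
            apply ENNReal.ofReal_le_ofReal
            have hmpos : (0:ℝ) < m.natAbs := by exact_mod_cast Int.natAbs_pos.mpr hm
            have h1 := hdiv m.natAbs (by simpa using hm)
            have h2 : (E.card:ℝ) ≤ 2 * m.natAbs.divisors.card := by exact_mod_cast hEc
            calc (E.card:ℝ) * (9 ^ (s/2) * (m.natAbs:ℝ)^(-(s/2)))
                ≤ (2 * (C * (m.natAbs:ℝ)^(s/2))) * (9 ^ (s/2) * (m.natAbs:ℝ)^(-(s/2))) := by
                  gcongr; linarith
              _ = 2 * C * 9 ^(s/2) * ((m.natAbs:ℝ)^(s/2) * (m.natAbs:ℝ)^(-(s/2))) := by ring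
              _ = _ := by rw [← Real.rpow_add hmpos]; simp

noncomputable def ja (x : ℝ) : ℝ := 1 + |x|
theorem ja_ge_one (x : ℝ) : 1 ≤ ja x := by unfold ja; linarith [abs_nonneg x]
theorem ja_pos (x : ℝ) : 0 < ja x := by linarith [ja_ge_one x]
theorem ja_neg (x : ℝ) : ja (-x) = ja x := by simp [ja]
theorem jb_pos (k : ℤ) : 0 < jb k := by linarith [jb_ge_one k]
@[fun_prop] theorem ja_cont : Continuous ja := by unfold ja; fun_prop
@[fun_prop] theorem ja_meas : Measurable ja := ja_cont.measurable

theorem lint_ja (r : ℝ) (hr : 1 < r) : ∫⁻ x : ℝ, ENNReal.ofReal (ja x ^ (-r)) ≠ ∞ := by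
  have := integrable_one_add_norm (μ := (volume : Measure ℝ)) (r := r) (by simpa using hr)
  have h := this.lintegral_lt_top
  simpa [ja] using h.ne

theorem ja_pointwise (p q : ℝ) (hq : 0 ≤ q) (hqp : q ≤ p) (a c m : ℝ) (ha : 1 ≤ a) (hc : 1 ≤ c)
    (hm : 1 ≤ m) (hmac : m ≤ a + c) :
    a ^ (-p) * c ^ (-p) ≤ 2 ^ (p - q) * m ^ (-(p-q)) * (a ^ (-(p+q)) + c ^ (-(p+q))) := by
  wlog h : a ≤ c generalizing a c
  · have := this c a hc ha (by linarith) (by linarith)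
    rw [mul_comm, add_comm (a ^ _)]; exact this
  have h1 : c ^ (-(p-q)) ≤ 2 ^ (p-q) * m ^ (-(p-q)) := by
    have : c ^ (-(p-q)) ≤ (m/2) ^ (-(p-q)) :=
      Real.rpow_le_rpow_of_nonpos (by linarith) (by linarith) (by linarith)
    refine this.trans (le_of_eq ?_)
    rw [Real.div_rpow (by linarith) (by norm_num), Real.rpow_neg (x := 2) (by norm_num)]
    field_simp
  have h2 : c ^ (-q) ≤ a ^ (-q) := Real.rpow_le_rpow_of_nonpos (by linarith) h (by linarith)
  have e1 : c ^ (-p) = c ^ (-(p-q)) * c ^ (-q) := by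
    rw [← Real.rpow_add (by linarith)]; congr 1; ring
  have e2 : a ^ (-(p+q)) = a ^ (-p) * a ^ (-q) := by
    rw [← Real.rpow_add (by linarith)]; congr 1; ring
  rw [e1]
  calc a ^ (-p) * (c ^ (-(p-q)) * c ^ (-q))
      ≤ a ^ (-p) * ((2 ^ (p-q) * m ^ (-(p-q))) * a ^ (-q)) := by gcongr
    _ = 2 ^ (p-q) * m ^ (-(p-q)) * a ^ (-(p+q)) := by rw [e2]; ring
    _ ≤ _ := by
      gcongr
      linarith [Real.rpow_nonneg (by linarith : 0 ≤ c) (-(p+q))]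

theorem J2_bound (p q : ℝ) (hq : 0 ≤ q) (hqp : q ≤ p) (hpq : 1 < p + q) :
    ∃ C : ℝ≥0∞, C ≠ ∞ ∧ ∀ A : ℝ,
      ∫⁻ σ : ℝ, ENNReal.ofReal (ja σ ^ (-p)) * ENNReal.ofReal (ja (A - σ) ^ (-p)) ≤
        C * ENNReal.ofReal (ja A ^ (-(p-q))) := by
  set L := ∫⁻ x : ℝ, ENNReal.ofReal (ja x ^ (-(p+q))) with hL
  have hLt : L ≠ ∞ := lint_ja _ hpq
  refine ⟨ENNReal.ofReal (2^(p-q)) * (L + L), by finiteness, fun A => ?_⟩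
  calc _ ≤ ∫⁻ σ : ℝ, ENNReal.ofReal (2 ^ (p - q) * ja A ^ (-(p-q))) *
        (ENNReal.ofReal (ja σ ^ (-(p+q))) + ENNReal.ofReal (ja (A-σ) ^ (-(p+q)))) := by
        apply lintegral_mono
        intro σ
        have h0 := fun x => Real.rpow_nonneg (ja_pos x).le
        dsimp only
        rw [← ENNReal.ofReal_mul (h0 _ _), ← ENNReal.ofReal_add (h0 _ _) (h0 _ _),
          ← ENNReal.ofReal_mul (by have := h0 A (-(p-q)); positivity)]
        apply ENNReal.ofReal_le_ofReal
        apply ja_pointwise p q hq hqp _ _ _ (ja_ge_one _) (ja_ge_one _) (ja_ge_one _)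
        unfold ja
        have := abs_add_le σ (A - σ)
        simp at this
        linarith
    _ = ENNReal.ofReal (2 ^ (p - q) * ja A ^ (-(p-q))) * (L + L) := by
        rw [lintegral_const_mul _ (by fun_prop), lintegral_add_left (by fun_prop)]
        congr 2
        exact lintegral_sub_left_eq_self (fun x => ENNReal.ofReal (ja x ^ (-(p+q)))) A
    _ = _ := by
        rw [ENNReal.ofReal_mul (by positivity)]; ring

theorem J3_bound (ε : ℝ) (hε : 0 < ε) (hε' : ε ≤ 1/22) :
    ∃ C : ℝ≥0∞, C ≠ ∞ ∧ ∀ A : ℝ,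
      ∫⁻ σ₁ : ℝ, ∫⁻ σ₂ : ℝ, ENNReal.ofReal (ja σ₁ ^ (-(1-2*ε))) *
        ENNReal.ofReal (ja σ₂ ^ (-(1-2*ε))) * ENNReal.ofReal (ja (σ₁ + σ₂ - A) ^ (-(1-2*ε))) ≤
        C * ENNReal.ofReal (ja A ^ (-(1-11*ε))) := by
  obtain ⟨C1, h1, H1⟩ := J2_bound (1-2*ε) (3*ε) (by linarith) (by linarith) (by linarith)
  obtain ⟨C2, h2, H2⟩ := J2_bound (1-5*ε) (6*ε) (by linarith) (by linarith) (by linarith)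
  refine ⟨C1 * C2, by finiteness, fun A => ?_⟩
  calc _ ≤ ∫⁻ σ₁ : ℝ, C1 * (ENNReal.ofReal (ja σ₁ ^ (-(1-5*ε))) * 
          ENNReal.ofReal (ja (A - σ₁) ^ (-(1-5*ε)))) := by
        apply lintegral_mono
        intro σ₁
        dsimp only
        have : ∀ σ₂, ja (σ₁ + σ₂ - A) = ja ((A - σ₁) - σ₂) := by
          intro σ₂; rw [← ja_neg]; congr 1; ring
        simp_rw [this, mul_assoc]
        rw [lintegral_const_mul _ (by fun_prop)]
        calc _ ≤ ENNReal.ofReal (ja σ₁ ^ (-(1-5*ε))) * 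
              (C1 * ENNReal.ofReal (ja (A - σ₁) ^ (-(1-2*ε-3*ε)))) := by
              gcongr
              · exact ja_ge_one _
              · linarith
              · exact H1 _
          _ = _ := by
            rw [show 1-2*ε-3*ε = 1-5*ε by ring]; ring
    _ ≤ C1 * (C2 * ENNReal.ofReal (ja A ^ (-(1-5*ε-6*ε)))) := by
        rw [lintegral_const_mul _ (by fun_prop)]
        gcongr
        exact H2 A
    _ = _ := by
        rw [show 1-5*ε-6*ε = 1-11*ε by ring]; ring

theorem sum_one_add_abs (r : ℝ) (hr : 1 < r) :
    ∑' m : ℤ, ENNReal.ofReal ((1 + |(m:ℝ)|) ^ (-r)) ≠ ∞ := by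
  have h := (Real.summable_abs_int_rpow hr)
  have h2 : Summable fun m : ℤ => |(m:ℝ)| ^ (-r) + if m = 0 then (1:ℝ) else 0 :=
    h.add (summable_of_hasFiniteSupport (Set.Finite.subset (Set.finite_singleton (0:ℤ)) (by
      intro x hx; simp at hx; simpa using hx)))
  have h3 : Summable fun m : ℤ => (1 + |(m:ℝ)|) ^ (-r) := by
    refine Summable.of_nonneg_of_le (fun m => by positivity) (fun m => ?_) h2
    split_ifs with hm
    · subst hm; simp; positivity
    · have : 0 < |(m:ℝ)| := by simpa using hm
      simp only [add_zero]
      exact Real.rpow_le_rpow_of_nonpos this (by linarith) (by linarith)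
  exact h3.tsum_ofReal_ne_top

theorem sum_ja_shift (r : ℝ) (hr : 1 < r) :
    ∃ C : ℝ≥0∞, C ≠ ∞ ∧ ∀ B : ℝ,
      ∑' m : ℤ, ENNReal.ofReal (ja (B - 4 * Real.pi * m) ^ (-r)) ≤ C := by
  refine ⟨_, sum_one_add_abs r hr, fun B => ?_⟩
  set m0 := round (B / (4 * Real.pi)) with hm0
  rw [← (Equiv.addRight m0).tsum_eq]
  apply ENNReal.tsum_le_tsum
  intro m
  apply ENNReal.ofReal_le_ofReal
  apply Real.rpow_le_rpow_of_nonpos (by positivity) _ (by linarith)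
  unfold ja
  suffices |(m:ℝ)| ≤ |B - 4 * Real.pi * ((Equiv.addRight m0 m : ℤ) : ℝ)| by linarith
  have h1 := abs_sub_round (B / (4 * Real.pi))
  rw [← hm0] at h1
  have hB : B - 4 * Real.pi * ((Equiv.addRight m0 m : ℤ) : ℝ) =
      4 * Real.pi * ((B / (4 * Real.pi) - m0) - m) := by
    have := Real.pi_pos
    simp; field_simp; ring
  rw [hB, abs_mul, abs_of_pos (by positivity : (0:ℝ) < 4 * Real.pi)]
  by_cases hm : m = 0
  · subst hm; simp; positivity
  have hm1 : (1:ℝ) ≤ |(m:ℝ)| := by exact_mod_cast Int.one_le_abs hm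
  have h2 : |(m:ℝ)| - 1/2 ≤ |(B / (4 * Real.pi) - m0) - m| := by
    have := abs_sub_abs_le_abs_sub (m:ℝ) (B / (4 * Real.pi) - m0)
    rw [abs_sub_comm (m:ℝ)] at this
    linarith
  nlinarith [Real.pi_gt_three]

theorem weight_sum (s : ℝ) (hs : 0 < s) (ε : ℝ) (hε : 0 < ε) (hε' : ε ≤ 1/22) (hεs : 48 * ε ≤ s) :
    ∃ C : ℝ≥0∞, C ≠ ∞ ∧ ∀ (k : ℤ) (B : ℝ),
      ∑' p : ℤ × ℤ, (if (p.1 - k) * (p.2 - k) ≠ 0 then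
        ENNReal.ofReal ((jb p.1 * jb p.2) ^ (-(2*s))) *
        ENNReal.ofReal (ja (B - 4 * Real.pi * ((p.1 - k) * (p.2 - k) : ℤ)) ^ (-(1-11*ε))) else 0)
        ≤ C := by
  obtain ⟨C1, hC1, H1⟩ := arith_sum s hs
  obtain ⟨C2, hC2, H2⟩ := sum_ja_shift (1+ε) (by linarith)
  set L := ∑' m : ℤ, ENNReal.ofReal ((1 + |(m:ℝ)|) ^ (-(2:ℝ))) with hL
  have hLt : L ≠ ∞ := sum_one_add_abs 2 (by norm_num)
  refine ⟨C1 * C2 + L * L, by finiteness, fun k B => ?_⟩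
  have hle : ∀ p : ℤ × ℤ, (if (p.1 - k) * (p.2 - k) ≠ 0 then
        ENNReal.ofReal ((jb p.1 * jb p.2) ^ (-(2*s))) *
        ENNReal.ofReal (ja (B - 4 * Real.pi * ((p.1 - k) * (p.2 - k) : ℤ)) ^ (-(1-11*ε))) else 0) ≤
      (∑' m : ℤ, if (p.1 - k) * (p.2 - k) = m then (if m ≠ 0 then 
        ENNReal.ofReal ((jb p.1 * jb p.2) ^ (-s)) * ENNReal.ofReal (ja (B - 4 * Real.pi * m) ^ (-(1+ε))) else 0) else 0) +
      ENNReal.ofReal ((1 + |(p.1:ℝ)|) ^ (-(2:ℝ))) * ENNReal.ofReal ((1 + |(p.2:ℝ)|) ^ (-(2:ℝ))) := by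
    intro p
    rw [tsum_eq_single ((p.1 - k) * (p.2 - k)) (fun m hm => if_neg (Ne.symm hm)), if_pos rfl]
    split_ifs with h
    · have ha := ja_ge_one (B - 4 * Real.pi * ((p.1 - k) * (p.2 - k) : ℤ))
      generalize ja (B - 4 * Real.pi * ((p.1 - k) * (p.2 - k) : ℤ)) = a at ha ⊢
      have hPl : (1 + |(p.1:ℝ)|) * (1 + |(p.2:ℝ)|) ≤ jb p.1 * jb p.2 := by
        have h1 := jb_ge p.1
        have h2 := jb_ge p.2
        gcongr
        · linarith [jb_ge_one p.1]
        · linarith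
        · linarith
      have hP1 : 1 ≤ jb p.1 * jb p.2 :=
        one_le_mul_of_one_le_of_one_le (jb_ge_one _) (jb_ge_one _)
      generalize jb p.1 * jb p.2 = P at hPl hP1 ⊢
      rw [← ENNReal.ofReal_mul (by positivity), ← ENNReal.ofReal_mul (by positivity),
        ← ENNReal.ofReal_mul (by positivity), ← ENNReal.ofReal_add (by positivity) (by positivity),
        ← Real.mul_rpow (by positivity) (by positivity)]
      apply ENNReal.ofReal_le_ofReal
      have hPP : P ^ (-(2:ℝ)) ≤ ((1 + |(p.1:ℝ)|) * (1 + |(p.2:ℝ)|)) ^ (-(2:ℝ)) :=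
        Real.rpow_le_rpow_of_nonpos (by positivity) hPl (by norm_num)
      rcases le_or_gt a (P ^ (4:ℝ)) with h4 | h4
      · have e1 : a ^ (-(1-11*ε)) = a ^ (-(1+ε)) * a ^ (12*ε) := by
          rw [← Real.rpow_add (by linarith)]; congr 1; ring
        have e2 : a ^ (12*ε) ≤ P ^ s := by
          calc a ^ (12*ε) ≤ (P ^ (4:ℝ)) ^ (12*ε) := by gcongr
            _ = P ^ (48*ε) := by rw [← Real.rpow_mul (by linarith)]; congr 1; ring
            _ ≤ _ := Real.rpow_le_rpow_of_exponent_le hP1 hεs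
        have e3 : P ^ (-(2*s)) * P ^ s = P ^ (-s) := by
          rw [← Real.rpow_add (by linarith)]; congr 1; ring
        calc P ^ (-(2*s)) * a ^ (-(1-11*ε)) ≤ P ^ (-(2*s)) * (a ^ (-(1+ε)) * P ^ s) := by
              rw [e1]; gcongr
          _ = P ^ (-s) * a ^ (-(1+ε)) := by rw [← e3]; ring
          _ ≤ _ := by linarith [Real.rpow_nonneg (by positivity : 0 ≤ ((1 + |(p.1:ℝ)|) * (1 + |(p.2:ℝ)|))) (-(2:ℝ))]
      · have e1 : P ^ (-(2*s)) ≤ 1 := Real.rpow_le_one_of_one_le_of_nonpos hP1 (by linarith)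
        have e2 : a ^ (-(1-11*ε)) ≤ P ^ (-(2:ℝ)) := by
          calc a ^ (-(1-11*ε)) ≤ (P ^ (4:ℝ)) ^ (-(1-11*ε)) :=
                Real.rpow_le_rpow_of_nonpos (by positivity) h4.le (by linarith)
            _ = P ^ (4 * (-(1-11*ε))) := by rw [← Real.rpow_mul (by linarith)]
            _ ≤ _ := Real.rpow_le_rpow_of_exponent_le hP1 (by linarith)
        calc P ^ (-(2*s)) * a ^ (-(1-11*ε)) ≤ 1 * P ^ (-(2:ℝ)) := by gcongr
          _ ≤ _ := by
            rw [one_mul]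
            refine hPP.trans ?_
            have : 0 ≤ P ^ (-s) * a ^ (-(1+ε)) := by positivity
            linarith
    · simp
  calc _ ≤ _ := ENNReal.tsum_le_tsum hle
    _ = _ := ENNReal.tsum_add
    _ ≤ _ := by
      gcongr
      · rw [ENNReal.tsum_comm]
        calc _ ≤ ∑' m : ℤ, C1 * ENNReal.ofReal (ja (B - 4 * Real.pi * m) ^ (-(1+ε))) := by
              apply ENNReal.tsum_le_tsum
              intro m
              by_cases hm : m = 0
              · simp [hm]
              · simp only [hm, ne_eq, not_false_eq_true, if_true]
                calc _ = ∑' p : ℤ × ℤ, (if (p.1 - k) * (p.2 - k) = m then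
                    ENNReal.ofReal ((jb p.1 * jb p.2) ^ (-s)) else 0) *
                      ENNReal.ofReal (ja (B - 4 * Real.pi * m) ^ (-(1+ε))) := by
                      congr 1; ext p; split_ifs <;> simp
                  _ = _ := ENNReal.tsum_mul_right
                  _ ≤ _ := by gcongr; exact H1 k m hm
          _ = _ := ENNReal.tsum_mul_left
          _ ≤ _ := by gcongr; exact H2 B
      · rw [ENNReal.tsum_prod']
        simp_rw [ENNReal.tsum_mul_left, ENNReal.tsum_mul_right]
        exact le_rfl

theorem cs_lint {α : Type*} [MeasurableSpace α] (μ : Measure α) {f g : α → ℝ≥0∞}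
    (hf : AEMeasurable f μ) (hg : AEMeasurable g μ) :
    (∫⁻ x, f x * g x ∂μ) ^ 2 ≤ (∫⁻ x, f x ^ 2 ∂μ) * (∫⁻ x, g x ^ 2 ∂μ) := by
  have h := ENNReal.lintegral_mul_le_Lp_mul_Lq μ Real.HolderConjugate.two_two hf hg
  simp only [Pi.mul_apply, ENNReal.rpow_ofNat] at h
  calc _ ≤ _ := pow_le_pow_left₀ zero_le h 2
    _ = _ := by
      rw [mul_pow, ← ENNReal.rpow_natCast, ← ENNReal.rpow_natCast, ← ENNReal.rpow_mul,
        ← ENNReal.rpow_mul]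
      simp

theorem cs_tsum {α : Type*} (f g : α → ℝ≥0∞) :
    (∑' x, f x * g x) ^ 2 ≤ (∑' x, f x ^ 2) * (∑' x, g x ^ 2) := by
  let _ : MeasurableSpace α := ⊤
  have h := cs_lint (Measure.count : Measure α) (f := f) (g := g)
    (measurable_from_top).aemeasurable (measurable_from_top).aemeasurable
  simpa [lintegral_count] using h

theorem sqrt_sq (a : ℝ≥0∞) : (a ^ (1/2:ℝ)) ^ 2 = a := by
  rw [← ENNReal.rpow_natCast, ← ENNReal.rpow_mul]; simp

theorem le_sqrt_of_sq_le {a b : ℝ≥0∞} (h : a ^ 2 ≤ b) : a ≤ b ^ (1/2:ℝ) := by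
  rw [← sqrt_sq b] at h
  exact (ENNReal.pow_le_pow_left_iff two_ne_zero).mp h

theorem ennreal_add_sq (a b : ℝ≥0∞) : (a + b) ^ 2 ≤ 2 * (a ^ 2 + b ^ 2) := by
  by_cases ha : a = ∞
  · simp [ha]
  by_cases hb : b = ∞
  · simp [hb]
  lift a to NNReal using ha
  lift b to NNReal using hb
  exact_mod_cast (add_sq_le (a := a) (b := b))


noncomputable def Iform (w : ℝ → ℝ≥0∞) (h1 h2 h3 : ℝ → ℝ≥0∞) (A : ℝ) : ℝ≥0∞ :=
  ∫⁻ σ₁ : ℝ, ∫⁻ σ₂ : ℝ, (w σ₁ * w σ₂ * w (σ₁ + σ₂ - A)) * (h1 σ₁ * h2 σ₂ * h3 (σ₁ + σ₂ - A))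

noncomputable def Rform (h1 h2 h3 : ℝ → ℝ≥0∞) (A : ℝ) : ℝ≥0∞ :=
  ∫⁻ σ₁ : ℝ, ∫⁻ σ₂ : ℝ, h1 σ₁ ^ 2 * h2 σ₂ ^ 2 * h3 (σ₁ + σ₂ - A) ^ 2


theorem Iform_sq_le {w : ℝ → ℝ≥0∞} (hw : Measurable w) {h1 h2 h3 : ℝ → ℝ≥0∞} (m1 : Measurable h1) (m2 : Measurable h2)
    (m3 : Measurable h3) (A : ℝ) :
    Iform w h1 h2 h3 A ^ 2 ≤
      (∫⁻ σ₁ : ℝ, ∫⁻ σ₂ : ℝ, w σ₁ ^ 2 * w σ₂ ^ 2 * w (σ₁ + σ₂ - A) ^ 2) * Rform h1 h2 h3 A := by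
  unfold Iform Rform
  have key := cs_lint ((volume : Measure ℝ).prod (volume : Measure ℝ))
    (f := fun z => w z.1 * w z.2 * w (z.1 + z.2 - A))
    (g := fun z => h1 z.1 * h2 z.2 * h3 (z.1 + z.2 - A)) (by fun_prop) (by fun_prop)
  rw [lintegral_prod _ (by fun_prop), lintegral_prod _ (by fun_prop),
    lintegral_prod _ (by fun_prop)] at key
  simpa only [mul_pow] using key

theorem Rform_meas {h1 h2 h3 : ℝ → ℝ≥0∞} (m1 : Measurable h1) (m2 : Measurable h2)
    (m3 : Measurable h3) : Measurable (Rform h1 h2 h3) := by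
  unfold Rform; fun_prop

theorem Rform_int {h1 h2 h3 : ℝ → ℝ≥0∞} (m1 : Measurable h1) (m2 : Measurable h2)
    (m3 : Measurable h3) (c : ℝ) :
    ∫⁻ B : ℝ, Rform h1 h2 h3 (B - c) =
      (∫⁻ σ, h1 σ ^ 2) * (∫⁻ σ, h2 σ ^ 2) * (∫⁻ σ, h3 σ ^ 2) := by
  rw [lintegral_sub_right_eq_self]
  unfold Rform
  rw [lintegral_lintegral_swap (by fun_prop)]
  have : ∀ σ₁ : ℝ, ∫⁻ B : ℝ, ∫⁻ σ₂ : ℝ, h1 σ₁ ^ 2 * h2 σ₂ ^ 2 * h3 (σ₁ + σ₂ - B) ^ 2 =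
      h1 σ₁ ^ 2 * ((∫⁻ σ, h2 σ ^ 2) * (∫⁻ σ, h3 σ ^ 2)) := by
    intro σ₁
    rw [lintegral_lintegral_swap (by fun_prop)]
    have : ∀ σ₂ : ℝ, ∫⁻ B : ℝ, h1 σ₁ ^ 2 * h2 σ₂ ^ 2 * h3 (σ₁ + σ₂ - B) ^ 2 =
        h1 σ₁ ^ 2 * (h2 σ₂ ^ 2 * ∫⁻ σ, h3 σ ^ 2) := by
      intro σ₂
      rw [lintegral_const_mul _ (by fun_prop),
        lintegral_sub_left_eq_self (fun x => h3 x ^ 2), mul_assoc]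
    simp_rw [this]
    rw [lintegral_const_mul _ (by fun_prop), lintegral_mul_const _ (by fun_prop)]
  simp_rw [this]
  rw [lintegral_mul_const _ (by fun_prop), mul_assoc]

noncomputable def Gsq (g : ℤ → ℝ → ℝ≥0∞) (σ : ℝ) : ℝ≥0∞ := (∑' k, g k σ ^ 2) ^ (1/2:ℝ)
theorem Gsq_meas {g : ℤ → ℝ → ℝ≥0∞} (m : ∀ k, Measurable (g k)) : Measurable (Gsq g) := by
  unfold Gsq; fun_prop
theorem Gsq_int {g : ℤ → ℝ → ℝ≥0∞} (m : ∀ k, Measurable (g k)) :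
    ∫⁻ σ, Gsq g σ ^ 2 = ∑' k, ∫⁻ σ, g k σ ^ 2 := by
  unfold Gsq
  simp_rw [sqrt_sq]
  rw [lintegral_tsum (fun k => by fun_prop)]
theorem Gsq_cs (g h : ℤ → ℝ → ℝ≥0∞) (σ τ : ℝ) :
    ∑' k, g k σ * h k τ ≤ Gsq g σ * Gsq h τ := by
  unfold Gsq
  rw [← ENNReal.mul_rpow_of_nonneg _ _ (by norm_num)]
  exact le_sqrt_of_sq_le (cs_tsum _ _)

theorem Iform_tsum23 {w : ℝ → ℝ≥0∞} (hw : Measurable w) {h1 : ℝ → ℝ≥0∞} {g2 g3 : ℤ → ℝ → ℝ≥0∞} (m1 : Measurable h1)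
    (m2 : ∀ k, Measurable (g2 k)) (m3 : ∀ k, Measurable (g3 k)) (A : ℝ) :
    ∑' k, Iform w h1 (g2 k) (g3 k) A ≤ Iform w h1 (Gsq g2) (Gsq g3) A := by
  unfold Iform
  rw [← lintegral_tsum (fun k => by have := m2 k; have := m3 k; fun_prop)]
  apply lintegral_mono; intro σ₁
  dsimp only
  rw [← lintegral_tsum (fun k => by have := m2 k; have := m3 k; fun_prop)]
  apply lintegral_mono; intro σ₂
  dsimp only
  rw [ENNReal.tsum_mul_left]
  gcongr
  simp_rw [mul_assoc]
  rw [ENNReal.tsum_mul_left]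
  gcongr
  exact Gsq_cs _ _ _ _

theorem Iform_tsum13 {w : ℝ → ℝ≥0∞} (hw : Measurable w) {h2 : ℝ → ℝ≥0∞} {g1 g3 : ℤ → ℝ → ℝ≥0∞} (m2 : Measurable h2)
    (m1 : ∀ k, Measurable (g1 k)) (m3 : ∀ k, Measurable (g3 k)) (A : ℝ) :
    ∑' k, Iform w (g1 k) h2 (g3 k) A ≤ Iform w (Gsq g1) h2 (Gsq g3) A := by
  unfold Iform
  rw [← lintegral_tsum (fun k => by have := m1 k; have := m3 k; fun_prop)]
  apply lintegral_mono; intro σ₁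
  dsimp only
  rw [← lintegral_tsum (fun k => by have := m1 k; have := m3 k; fun_prop)]
  apply lintegral_mono; intro σ₂
  dsimp only
  rw [ENNReal.tsum_mul_left]
  gcongr
  have : ∀ k, g1 k σ₁ * h2 σ₂ * g3 k (σ₁ + σ₂ - A) = h2 σ₂ * (g1 k σ₁ * g3 k (σ₁ + σ₂ - A)) :=
    fun k => by ring
  simp_rw [this]
  rw [ENNReal.tsum_mul_left]
  calc _ ≤ h2 σ₂ * (Gsq g1 σ₁ * Gsq g3 (σ₁ + σ₂ - A)) := by gcongr; exact Gsq_cs _ _ _ _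
    _ = _ := by ring

theorem core_trilinear {w : ℝ → ℝ≥0∞} (hw : Measurable w) (q : ℤ → ℝ≥0∞) (hq : ∀ k, q k ≤ 1) (J : ℝ → ℝ≥0∞) (CJ CS : ℝ≥0∞)
    (hJ : ∀ A, ∫⁻ σ₁ : ℝ, ∫⁻ σ₂ : ℝ, w σ₁ ^ 2 * w σ₂ ^ 2 * w (σ₁ + σ₂ - A) ^ 2 ≤ J A)
    (hJC : ∀ A, J A ≤ CJ)
    (hS : ∀ (k : ℤ) (B : ℝ), ∑' p : ℤ × ℤ, (if (p.1 - k) * (p.2 - k) ≠ 0 then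
        (q p.1 * q p.2) ^ 2 * J (B - 4 * Real.pi * ((p.1 - k) * (p.2 - k) : ℤ)) else 0) ≤ CS)
    {g1 g2 g3 : ℤ → ℝ → ℝ≥0∞}
    (m1 : ∀ k, Measurable (g1 k)) (m2 : ∀ k, Measurable (g2 k)) (m3 : ∀ k, Measurable (g3 k)) :
    ∑' k : ℤ, ∫⁻ B : ℝ, (∑' p : ℤ × ℤ, q p.1 * q p.2 * Iform w (g1 p.1) (g2 p.2) (g3 (p.1 + p.2 - k))
      (B - 4 * Real.pi * ((p.1 - k) * (p.2 - k) : ℤ))) ^ 2 ≤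
      4 * (CS + CJ + CJ) * ((∑' k, ∫⁻ σ, g1 k σ ^ 2) * (∑' k, ∫⁻ σ, g2 k σ ^ 2) *
        (∑' k, ∫⁻ σ, g3 k σ ^ 2)) := by
  have hI : ∀ {h1 h2 h3 : ℝ → ℝ≥0∞} (m1 : Measurable h1) (m2 : Measurable h2)
    (m3 : Measurable h3) (A : ℝ), Iform w h1 h2 h3 A ^ 2 ≤ J A * Rform h1 h2 h3 A := by
    intro h1 h2 h3 m1 m2 m3 A
    exact (Iform_sq_le hw m1 m2 m3 A).trans (by gcongr; exact hJ A)
  set RS : ℤ → ℝ → ℝ≥0∞ := fun k B => ∑' p : ℤ × ℤ, Rform (g1 p.1) (g2 p.2) (g3 (p.1 + p.2 - k))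
      (B - 4 * Real.pi * ((p.1 - k) * (p.2 - k) : ℤ)) with hRS
  have hpt : ∀ (k : ℤ) (B : ℝ), (∑' p : ℤ × ℤ, q p.1 * q p.2 *
      Iform w (g1 p.1) (g2 p.2) (g3 (p.1 + p.2 - k))
      (B - 4 * Real.pi * ((p.1 - k) * (p.2 - k) : ℤ))) ^ 2 ≤ 
      4 * (CS * RS k B + CJ * Rform (g1 k) (Gsq g2) (Gsq g3) (B - 0) +
        CJ * Rform (Gsq g1) (g2 k) (Gsq g3) (B - 0)) := by
    intro k B
    set X : ℤ × ℤ → ℝ≥0∞ := fun p => q p.1 * q p.2 *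
      Iform w (g1 p.1) (g2 p.2) (g3 (p.1 + p.2 - k))
      (B - 4 * Real.pi * ((p.1 - k) * (p.2 - k) : ℤ)) with hX
    have hXle : ∀ p, X p ≤ (if (p.1 - k) * (p.2 - k) ≠ 0 then X p else 0) +
        ((if p.1 = k then X p else 0) + (if p.2 = k then X p else 0)) := by
      intro p
      by_cases h1 : p.1 = k
      · simp only [h1, if_true]
        exact le_trans le_self_add le_add_self
      · by_cases h2 : p.2 = k
        · simp only [h2, if_true]
          exact le_trans le_add_self le_add_self
        · have : (p.1 - k) * (p.2 - k) ≠ 0 := mul_ne_zero (sub_ne_zero.mpr h1) (sub_ne_zero.mpr h2)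
          rw [if_pos this]
          exact le_self_add
    have hN : (∑' p : ℤ × ℤ, if (p.1 - k) * (p.2 - k) ≠ 0 then X p else 0) ^ 2 ≤ CS * RS k B := by
      calc _ ≤ (∑' p : ℤ × ℤ, (if (p.1 - k) * (p.2 - k) ≠ 0 then q p.1 * q p.2 *
              J (B - 4 * Real.pi * ((p.1 - k) * (p.2 - k) : ℤ)) ^ (1/2:ℝ) else 0) *
              Rform (g1 p.1) (g2 p.2) (g3 (p.1 + p.2 - k))
              (B - 4 * Real.pi * ((p.1 - k) * (p.2 - k) : ℤ)) ^ (1/2:ℝ)) ^ 2 := by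
            gcongr with p
            split_ifs with h
            · simp only [hX]
              rw [mul_assoc (q p.1 * q p.2), ← ENNReal.mul_rpow_of_nonneg _ _ (by norm_num)]
              gcongr
              exact le_sqrt_of_sq_le (hI (m1 _) (m2 _) (m3 _) _)
            · simp
        _ ≤ _ := cs_tsum _ _
        _ ≤ _ := by
            gcongr ?_ * ?_
            · refine le_trans (le_of_eq ?_) (hS k B)
              congr 1; ext p
              split_ifs with h
              · rw [mul_pow, sqrt_sq]
              · simp
            · simp only [hRS, sqrt_sq]
              exact le_rfl
    have hqq : ∀ a b, q a * q b ≤ 1 := fun a b => mul_le_one' (hq a) (hq b)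
    have hA : (∑' p : ℤ × ℤ, if p.1 = k then X p else 0) ^ 2 ≤
        CJ * Rform (g1 k) (Gsq g2) (Gsq g3) (B - 0) := by
      rw [sub_zero]
      calc _ ≤ (Iform w (g1 k) (Gsq g2) (Gsq g3) B) ^ 2 := by
            gcongr
            rw [ENNReal.tsum_prod', tsum_eq_single k (fun a ha => by simp [ha])]
            refine le_trans ?_ (Iform_tsum23 hw (m1 k) m2 m3 B)
            apply ENNReal.tsum_le_tsum
            intro b
            simp only [if_true, hX]
            have e2 : ∀ a c : ℤ, a + c - a = c := fun a c => by ring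
            have e3 : ∀ a c : ℤ, c + a - a = c := fun a c => by ring
            simp only [sub_self, zero_mul, mul_zero, Int.cast_zero, sub_zero, e2, e3]
            exact mul_le_of_le_one_left zero_le (hqq _ _)
        _ ≤ _ := hI (m1 k) (Gsq_meas m2) (Gsq_meas m3) B
        _ ≤ _ := by gcongr; exact hJC B
    have hB : (∑' p : ℤ × ℤ, if p.2 = k then X p else 0) ^ 2 ≤
        CJ * Rform (Gsq g1) (g2 k) (Gsq g3) (B - 0) := by
      rw [sub_zero]
      calc _ ≤ (Iform w (Gsq g1) (g2 k) (Gsq g3) B) ^ 2 := by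
            gcongr
            rw [ENNReal.tsum_prod']
            refine le_trans ?_ (Iform_tsum13 hw (m2 k) m1 m3 B)
            apply ENNReal.tsum_le_tsum
            intro b
            rw [tsum_eq_single k (fun a ha => by simp [ha])]
            simp only [if_true, hX]
            have e2 : ∀ a c : ℤ, a + c - a = c := fun a c => by ring
            have e3 : ∀ a c : ℤ, c + a - a = c := fun a c => by ring
            simp only [sub_self, zero_mul, mul_zero, Int.cast_zero, sub_zero, e2, e3]
            exact mul_le_of_le_one_left zero_le (hqq _ _)
        _ ≤ _ := hI (Gsq_meas m1) (m2 k) (Gsq_meas m3) B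
        _ ≤ _ := by gcongr; exact hJC B
    calc (∑' p, X p) ^ 2 ≤ _ := pow_le_pow_left₀ zero_le (ENNReal.tsum_le_tsum hXle) 2
      _ = ((∑' p : ℤ × ℤ, if (p.1 - k) * (p.2 - k) ≠ 0 then X p else 0) + 
          ((∑' p : ℤ × ℤ, if p.1 = k then X p else 0) + (∑' p : ℤ × ℤ, if p.2 = k then X p else 0))) ^ 2 := by
          rw [ENNReal.tsum_add, ENNReal.tsum_add]
      _ ≤ 2 * (CS * RS k B + 2 * (CJ * Rform (g1 k) (Gsq g2) (Gsq g3) (B - 0) + 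
          CJ * Rform (Gsq g1) (g2 k) (Gsq g3) (B - 0))) := by
          refine (ennreal_add_sq _ _).trans ?_
          gcongr
          refine (ennreal_add_sq _ _).trans ?_
          gcongr
      _ ≤ 2 * (2 * (CS * RS k B) + 2 * (CJ * Rform (g1 k) (Gsq g2) (Gsq g3) (B - 0) + 
          CJ * Rform (Gsq g1) (g2 k) (Gsq g3) (B - 0))) := by
          gcongr 2 * (?_ + _)
          exact le_mul_of_one_le_left zero_le (one_le_two : (1:ℝ≥0∞) ≤ 2)
      _ = _ := by ring
  have hmR : ∀ k (p : ℤ × ℤ), Measurable fun B : ℝ => Rform (g1 p.1) (g2 p.2) (g3 (p.1 + p.2 - k))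
      (B - 4 * Real.pi * ((p.1 - k) * (p.2 - k) : ℤ)) := fun k p =>
    (Rform_meas (m1 _) (m2 _) (m3 _)).comp (by fun_prop)
  have hmRS : ∀ k, Measurable (RS k) := fun k => by
    simp only [hRS]
    exact Measurable.tsum (hmR k)
  have hR0 : ∀ k, ∫⁻ B, RS k B = ∑' p : ℤ × ℤ, (∫⁻ σ, g1 p.1 σ ^ 2) * (∫⁻ σ, g2 p.2 σ ^ 2) *
      (∫⁻ σ, g3 (p.1 + p.2 - k) σ ^ 2) := by
    intro k
    simp only [hRS]
    rw [lintegral_tsum (fun p => (hmR k p).aemeasurable)]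
    congr 1; ext p
    exact Rform_int (m1 _) (m2 _) (m3 _) _
  have hR1 : ∑' k, ∫⁻ B, RS k B = (∑' k, ∫⁻ σ, g1 k σ ^ 2) * (∑' k, ∫⁻ σ, g2 k σ ^ 2) *
        (∑' k, ∫⁻ σ, g3 k σ ^ 2) := by
    simp_rw [hR0]
    rw [ENNReal.tsum_comm]
    have : ∀ p : ℤ × ℤ, ∑' k, (∫⁻ σ, g1 p.1 σ ^ 2) * (∫⁻ σ, g2 p.2 σ ^ 2) *
      (∫⁻ σ, g3 (p.1 + p.2 - k) σ ^ 2) = (∫⁻ σ, g1 p.1 σ ^ 2) * ((∫⁻ σ, g2 p.2 σ ^ 2) *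
        ∑' k, ∫⁻ σ, g3 k σ ^ 2) := by
      intro p
      rw [ENNReal.tsum_mul_left, mul_assoc]
      congr 2
      exact (Equiv.subLeft (p.1 + p.2)).tsum_eq (fun k => ∫⁻ σ, g3 k σ ^ 2)
    simp_rw [this]
    rw [ENNReal.tsum_prod']
    simp_rw [ENNReal.tsum_mul_left, ENNReal.tsum_mul_right]
    ring
  have hmA : ∀ k, Measurable fun B : ℝ => Rform (g1 k) (Gsq g2) (Gsq g3) (B - 0) := fun k =>
    (Rform_meas (m1 _) (Gsq_meas m2) (Gsq_meas m3)).comp (by fun_prop)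
  have hmB : ∀ k, Measurable fun B : ℝ => Rform (Gsq g1) (g2 k) (Gsq g3) (B - 0) := fun k =>
    (Rform_meas (Gsq_meas m1) (m2 _) (Gsq_meas m3)).comp (by fun_prop)
  calc _ ≤ ∑' k : ℤ, ∫⁻ B : ℝ, 4 * (CS * RS k B + CJ * Rform (g1 k) (Gsq g2) (Gsq g3) (B - 0) +
        CJ * Rform (Gsq g1) (g2 k) (Gsq g3) (B - 0)) := by
        gcongr with k B
        exact hpt k B
    _ = ∑' k : ℤ, 4 * (CS * (∫⁻ B, RS k B) + 
        CJ * ((∫⁻ σ, g1 k σ ^ 2) * (∑' k, ∫⁻ σ, g2 k σ ^ 2) * (∑' k, ∫⁻ σ, g3 k σ ^ 2)) +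
        CJ * ((∑' k, ∫⁻ σ, g1 k σ ^ 2) * (∫⁻ σ, g2 k σ ^ 2) * (∑' k, ∫⁻ σ, g3 k σ ^ 2))) := by
        congr 1; ext k
        have a1 := hmRS k
        have a2 := hmA k
        have a3 := hmB k
        rw [lintegral_const_mul _ (by fun_prop), lintegral_add_left (by fun_prop),
          lintegral_add_left (by fun_prop), lintegral_const_mul _ (by fun_prop),
          lintegral_const_mul _ (by fun_prop), lintegral_const_mul _ (by fun_prop),
          Rform_int (m1 _) (Gsq_meas m2) (Gsq_meas m3),
          Rform_int (Gsq_meas m1) (m2 _) (Gsq_meas m3), Gsq_int m1, Gsq_int m2, Gsq_int m3]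
    _ = _ := by
        rw [ENNReal.tsum_mul_left, ENNReal.tsum_add, ENNReal.tsum_add, ENNReal.tsum_mul_left,
          ENNReal.tsum_mul_left, ENNReal.tsum_mul_left, ENNReal.tsum_mul_right,
          ENNReal.tsum_mul_right, ENNReal.tsum_mul_right, ENNReal.tsum_mul_left, hR1]
        ring

theorem l2_dual {α : Type*} [MeasurableSpace α] (μ : Measure α) [SigmaFinite μ] {H : α → ℝ≥0∞}
    (hH : Measurable H) (K : ℝ≥0∞)
    (h : ∀ φ : α → ℝ≥0∞, Measurable φ → (∫⁻ x, H x * φ x ∂μ) ^ 2 ≤ K * ∫⁻ x, φ x ^ 2 ∂μ) :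
    ∫⁻ x, H x ^ 2 ∂μ ≤ K := by
  by_contra hlt
  push Not at hlt
  simp_rw [lintegral_eq_nnreal, lt_iSup_iff] at hlt
  rcases hlt with ⟨g₀, hg₀, g₀L⟩
  have g₀L' : K < ∫⁻ x, g₀ x ∂μ := by
    convert! g₀L
    rw [← SimpleFunc.lintegral_eq_lintegral, SimpleFunc.coe_map]
    simp only [Function.comp_apply]
  obtain ⟨g, hg, hgf, hgK⟩ := SimpleFunc.exists_lt_lintegral_simpleFunc_of_lt_lintegral g₀L'
  set φ : α → ℝ≥0∞ := fun x => (g x : ℝ≥0∞) ^ (1/2:ℝ) with hφ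
  have hφm : Measurable φ := by
    have := g.measurable
    fun_prop
  have hφ2 : ∀ x, φ x ^ 2 = g x := fun x => sqrt_sq _
  have hφH : ∀ x, φ x ≤ H x := by
    intro x
    refine (ENNReal.pow_le_pow_left_iff two_ne_zero).mp ?_
    rw [hφ2]
    exact le_trans (by exact_mod_cast hg x) (hg₀ x)
  have h1 := h φ hφm
  simp only [hφ2] at h1
  have h2 : (∫⁻ x, g x ∂μ) ≤ ∫⁻ x, H x * φ x ∂μ := by
    apply lintegral_mono
    intro x
    simp only
    rw [← hφ2, sq]
    gcongr
    exact hφH x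
  have h3 : (∫⁻ x, g x ∂μ) * (∫⁻ x, g x ∂μ) ≤ K * ∫⁻ x, g x ∂μ := by
    rw [← sq]
    exact (pow_le_pow_left₀ zero_le h2 2).trans h1
  have h4 := (ENNReal.mul_le_mul_iff_left (ne_of_gt (lt_of_le_of_lt zero_le hgK)) hgf.ne).mp h3
  exact absurd hgK (not_lt.mpr h4)

section conv
variable {G : Type*} [AddCommGroup G] [MeasurableSpace G] [MeasurableAdd₂ G] [MeasurableNeg G]
  {μ : Measure G} [μ.IsAddLeftInvariant] [μ.IsNegInvariant] [SFinite μ]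

def rf (F : G → ℝ≥0∞) : G → ℝ≥0∞ := fun x => F (-x)

@[fun_prop] theorem rf_meas {F : G → ℝ≥0∞} (h : Measurable F) : Measurable (rf F) := h.comp measurable_neg

theorem rf_rf (F : G → ℝ≥0∞) : rf (rf F) = F := by ext x; simp [rf]

theorem conv_pair {P Q R : G → ℝ≥0∞} (hP : Measurable P) (hQ : Measurable Q) (hR : Measurable R) :
    ∫⁻ x, P x * (Q ⋆ₗ[μ] R) x ∂μ = ∫⁻ x, (P ⋆ₗ[μ] rf R) x * Q x ∂μ := by
  simp only [lconvolution_def, rf]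
  have e1 : ∀ x, P x * ∫⁻ y, Q y * R (-y + x) ∂μ = ∫⁻ y, P x * (Q y * R (-y + x)) ∂μ :=
    fun x => (lintegral_const_mul _ (by fun_prop)).symm
  have e2 : ∀ x, (∫⁻ y, P y * R (-(-y + x)) ∂μ) * Q x = ∫⁻ y, (P y * R (-(-y + x))) * Q x ∂μ :=
    fun x => (lintegral_mul_const _ (by fun_prop)).symm
  simp_rw [e1, e2]
  rw [lintegral_lintegral_swap (by fun_prop)]
  congr 1; ext y; congr 1; ext x
  rw [neg_add, neg_neg, add_comm x (-y)]; ring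

theorem conv_flip {F K : G → ℝ≥0∞} (hF : Measurable F) (hK : Measurable K) :
    ∫⁻ x, (F ⋆ₗ[μ] K) x ^ 2 ∂μ = ∫⁻ x, (F ⋆ₗ[μ] rf K) x ^ 2 ∂μ := by
  simp only [sq]
  rw [conv_pair (by fun_prop) hF hK, conv_pair (by fun_prop) hF (by fun_prop), rf_rf,
    ← lconvolution_assoc hF hK (by fun_prop), ← lconvolution_assoc hF (by fun_prop) hK,
    lconvolution_comm (f := K)]

def fl (e : Bool) (F : G → ℝ≥0∞) : G → ℝ≥0∞ := if e then rf F else F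

@[fun_prop] theorem fl_meas (e : Bool) {F : G → ℝ≥0∞} (h : Measurable F) : Measurable (fl e F) := by
  unfold fl; split_ifs <;> fun_prop

theorem conv_fl (e : Bool) {F K : G → ℝ≥0∞} (hF : Measurable F) (hK : Measurable K) :
    ∫⁻ x, (F ⋆ₗ[μ] fl e K) x ^ 2 ∂μ = ∫⁻ x, (F ⋆ₗ[μ] K) x ^ 2 ∂μ := by
  unfold fl; split_ifs
  · exact (conv_flip hF hK).symm
  · rfl

theorem conv_left_comm {A B C : G → ℝ≥0∞} (hA : Measurable A) (hB : Measurable B) (hC : Measurable C) :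
    A ⋆ₗ[μ] (B ⋆ₗ[μ] C) = B ⋆ₗ[μ] (A ⋆ₗ[μ] C) := by
  rw [lconvolution_assoc hA hB hC, lconvolution_assoc hB hA hC, lconvolution_comm (f := A)]

theorem conv_fl3 (a b c : Bool) {X Y Z : G → ℝ≥0∞} (hX : Measurable X) (hY : Measurable Y)
    (hZ : Measurable Z) :
    ∫⁻ x, (fl a X ⋆ₗ[μ] (fl b Y ⋆ₗ[μ] fl c Z)) x ^ 2 ∂μ = ∫⁻ x, (X ⋆ₗ[μ] (Y ⋆ₗ[μ] Z)) x ^ 2 ∂μ := by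
  rw [lconvolution_comm, conv_fl a (by fun_prop) hX, lconvolution_comm,
    conv_left_comm hX (by fun_prop) (by fun_prop), lconvolution_comm, conv_fl b (by fun_prop) hY,
    lconvolution_comm, lconvolution_assoc hY hX (by fun_prop), conv_fl c (by fun_prop) hZ,
    ← lconvolution_assoc hY hX hZ, conv_left_comm hX hY hZ]

/-- Leibniz. -/
theorem conv_leib {W F K : G → ℝ≥0∞} {c : ℝ≥0∞} (hW : ∀ x y, W (x + y) ≤ c * (W x + W y))
    (hWm : Measurable W) (hF : Measurable F) (hK : Measurable K) (x : G) :
    W x * (F ⋆ₗ[μ] K) x ≤ c * (((fun x => W x * F x) ⋆ₗ[μ] K) x + (F ⋆ₗ[μ] (fun x => W x * K x)) x) := by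
  simp only [lconvolution_def]
  rw [← lintegral_const_mul _ (by fun_prop), ← lintegral_add_left (by fun_prop),
    ← lintegral_const_mul _ (by fun_prop)]
  apply lintegral_mono
  intro y
  have := hW y (-y + x)
  rw [add_neg_cancel_left] at this
  calc W x * (F y * K (-y + x)) ≤ c * (W y + W (-y + x)) * (F y * K (-y + x)) := by gcongr
    _ = _ := by ring


theorem conv_mono {F F' K K' : G → ℝ≥0∞} (h1 : F ≤ F') (h2 : K ≤ K') : F ⋆ₗ[μ] K ≤ F' ⋆ₗ[μ] K' := by
  intro x
  simp only [lconvolution_def]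
  exact lintegral_mono fun y => mul_le_mul' (h1 _) (h2 _)

theorem add_conv {F F' K : G → ℝ≥0∞} (hF : Measurable F) (hK : Measurable K) :
    (F + F') ⋆ₗ[μ] K = F ⋆ₗ[μ] K + F' ⋆ₗ[μ] K := by
  ext x
  simp only [lconvolution_def, Pi.add_apply, add_mul]
  rw [lintegral_add_left (by fun_prop)]

theorem smul_conv {F K : G → ℝ≥0∞} (c : ℝ≥0∞) (hF : Measurable F) (hK : Measurable K) :
    (c • F) ⋆ₗ[μ] K = c • (F ⋆ₗ[μ] K) := by
  ext x
  simp only [lconvolution_def, Pi.smul_apply, smul_eq_mul, mul_assoc]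
  rw [lintegral_const_mul _ (by fun_prop)]

theorem conv_leib' {W F K F' K' : G → ℝ≥0∞} {c : ℝ≥0∞} (hW : ∀ x y, W (x + y) ≤ c * (W x + W y))
    (hWm : Measurable W) (hF : Measurable F) (hK : Measurable K) 
    (h1 : W * F ≤ F') (h2 : W * K ≤ K') :
    W * (F ⋆ₗ[μ] K) ≤ c • (F' ⋆ₗ[μ] K + F ⋆ₗ[μ] K') := by
  intro x
  refine (conv_leib hW hWm hF hK x).trans ?_
  simp only [Pi.smul_apply, Pi.add_apply, smul_eq_mul]
  gcongr
  · exact conv_mono h1 le_rfl x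
  · exact conv_mono le_rfl h2 x

def MFn (G : Type*) [MeasurableSpace G] := {F : G → ℝ≥0∞ // Measurable F}

noncomputable def mc (μ : Measure G) [SFinite μ] (F K : MFn G) : MFn G :=
  ⟨F.1 ⋆ₗ[μ] K.1, measurable_lconvolution μ F.2 K.2⟩

instance : Std.Associative (mc (G := G) μ) :=
  ⟨fun a b c => Subtype.ext (lconvolution_assoc a.2 b.2 c.2).symm⟩
instance : Std.Commutative (mc (G := G) μ) :=
  ⟨fun _ _ => Subtype.ext lconvolution_comm⟩

theorem six_term [SigmaFinite μ] {u w : G → ℝ≥0∞} (hu : Measurable u) (hw : Measurable w) {K : ℝ≥0∞}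
    (T : ∀ f1 f2 f3 : G → ℝ≥0∞, Measurable f1 → Measurable f2 → Measurable f3 →
      ∫⁻ x, ((f1 * u) ⋆ₗ[μ] ((f2 * u) ⋆ₗ[μ] (rf (f3 * w)))) x ^ 2 ∂μ ≤
        K * ((∫⁻ x, f1 x ^ 2 ∂μ) * (∫⁻ x, f2 x ^ 2 ∂μ) * (∫⁻ x, f3 x ^ 2 ∂μ)))
    {a b z c d : G → ℝ≥0∞} (ha : Measurable a) (hb : Measurable b) (hz : Measurable z)
    (hc : Measurable c) (hd : Measurable d) (ea eb ez ec ed : Bool) :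
    ∫⁻ x, (w x * ((fl ea (a * u) ⋆ₗ[μ] (fl eb (b * u) ⋆ₗ[μ] fl ez (z * w))) ⋆ₗ[μ]
        (fl ec (c * u) ⋆ₗ[μ] fl ed (d * u))) x) ^ 2 ∂μ ≤
      (K * K) * ((∫⁻ x, a x ^ 2 ∂μ) * (∫⁻ x, b x ^ 2 ∂μ) * (∫⁻ x, z x ^ 2 ∂μ) * 
        (∫⁻ x, c x ^ 2 ∂μ) * (∫⁻ x, d x ^ 2 ∂μ)) := by
  have T' : ∀ (e1 e2 e3 : Bool) (f1 f2 f3 : G → ℝ≥0∞), Measurable f1 → Measurable f2 → Measurable f3 →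
      ∫⁻ x, (fl e1 (f1 * u) ⋆ₗ[μ] (fl e2 (f2 * u) ⋆ₗ[μ] (fl e3 (f3 * w)))) x ^ 2 ∂μ ≤
        K * ((∫⁻ x, f1 x ^ 2 ∂μ) * (∫⁻ x, f2 x ^ 2 ∂μ) * (∫⁻ x, f3 x ^ 2 ∂μ)) := by
    intro e1 e2 e3 f1 f2 f3 m1 m2 m3
    refine le_trans (le_of_eq ?_) (T f1 f2 f3 m1 m2 m3)
    rw [conv_fl3 e1 e2 e3 (by fun_prop) (by fun_prop) (by fun_prop)]
    exact (conv_fl3 false false true (X := f1 * u) (Y := f2 * u) (Z := f3 * w)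
      (by fun_prop) (by fun_prop) (by fun_prop)).symm
  apply l2_dual μ (by fun_prop)
  intro φ hφ
  set P := fl ea (a * u) ⋆ₗ[μ] (fl eb (b * u) ⋆ₗ[μ] fl ez (z * w)) with hP
  set Q := fl ec (c * u) ⋆ₗ[μ] fl ed (d * u) with hQ
  have hPm : Measurable P := by fun_prop
  have hQm : Measurable Q := by fun_prop
  have e0 : ∫⁻ x, (w x * (P ⋆ₗ[μ] Q) x) * φ x ∂μ = ∫⁻ x, ((φ * w) ⋆ₗ[μ] rf Q) x * P x ∂μ := by
    rw [← conv_pair (by fun_prop) hPm hQm]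
    congr 1; ext x
    simp only [Pi.mul_apply]; ring
  rw [e0]
  refine (cs_lint μ (by fun_prop) (by fun_prop)).trans ?_
  rw [← conv_flip (by fun_prop) hQm, lconvolution_comm, hQ,
    ← lconvolution_assoc (by fun_prop) (by fun_prop) (by fun_prop)]
  refine (mul_le_mul' (T' ec ed false c d φ hc hd hφ) (T' ea eb ez a b z ha hb hz)).trans ?_
  apply le_of_eq; ring

theorem six_lin [SigmaFinite μ] {u w W : G → ℝ≥0∞} (hu : Measurable u) (hw : Measurable w)
    (hWm : Measurable W) {K κ : ℝ≥0∞} (hWu : W * u ≤ w) (hWe : ∀ x, W (-x) = W x)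
    (hW : ∀ x y, W (x + y) ≤ κ * (W x + W y))
    (T : ∀ f1 f2 f3 : G → ℝ≥0∞, Measurable f1 → Measurable f2 → Measurable f3 →
      ∫⁻ x, ((f1 * u) ⋆ₗ[μ] ((f2 * u) ⋆ₗ[μ] (rf (f3 * w)))) x ^ 2 ∂μ ≤
        K * ((∫⁻ x, f1 x ^ 2 ∂μ) * (∫⁻ x, f2 x ^ 2 ∂μ) * (∫⁻ x, f3 x ^ 2 ∂μ)))
    {f : Fin 5 → G → ℝ≥0∞} (hf : ∀ j, Measurable (f j)) (e : Fin 5 → Bool) :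
    ∫⁻ x, (w x * (W x * (((fl (e 0) (f 0 * u) ⋆ₗ[μ] fl (e 1) (f 1 * u)) ⋆ₗ[μ] 
        (fl (e 2) (f 2 * u) ⋆ₗ[μ] fl (e 3) (f 3 * u))) ⋆ₗ[μ] fl (e 4) (f 4 * u)) x)) ^ 2 ∂μ ≤
      (2 * κ ^ 2 * (2 * κ ^ 2 * (2 * κ ^ 2 * 4) + 1) * (K * K)) * ∏ j, ∫⁻ x, f j x ^ 2 ∂μ := by
  set X : Fin 5 → G → ℝ≥0∞ := fun j => fl (e j) (f j * u) with hX
  set Z : Fin 5 → G → ℝ≥0∞ := fun j => fl (e j) (f j * w) with hZ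
  have mX : ∀ j, Measurable (X j) := fun j => by have := hf j; simp only [hX]; fun_prop
  have mZ : ∀ j, Measurable (Z j) := fun j => by have := hf j; simp only [hZ]; fun_prop
  have hWX : ∀ j, W * X j ≤ Z j := by
    intro j x
    simp only [hX, hZ, fl, Pi.mul_apply]
    split_ifs
    · have := hWu (-x)
      simp only [Pi.mul_apply] at this
      rw [← hWe x]
      change W (-x) * (f j (-x) * u (-x)) ≤ f j (-x) * w (-x)
      calc _ = f j (-x) * (W (-x) * u (-x)) := by ring
        _ ≤ _ := by gcongr
    · have := hWu x
      simp only [Pi.mul_apply] at this ⊢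
      calc _ = f j (x) * (W (x) * u (x)) := by ring
        _ ≤ _ := by gcongr
  have l01 := conv_leib' (μ := μ) hW hWm (mX 0) (mX 1) (hWX 0) (hWX 1)
  have l23 := conv_leib' (μ := μ) hW hWm (mX 2) (mX 3) (hWX 2) (hWX 3)
  have m0 := mX 0
  have m1 := mX 1
  have m2 := mX 2
  have m3 := mX 3
  have m4 := mX 4
  have n0 := mZ 0
  have n1 := mZ 1
  have n2 := mZ 2
  have n3 := mZ 3
  have n4 := mZ 4
  have lP := conv_leib' (μ := μ) hW hWm (by fun_prop) (by fun_prop) l01 l23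
  have lM := conv_leib' (μ := μ) hW hWm (by fun_prop) (mX 4) lP (hWX 4)
  set Bf : (G → ℝ≥0∞) → ℝ≥0∞ := fun F => ∫⁻ x, (w x * F x) ^ 2 ∂μ with hBf
  have Bmono : ∀ {F F' : G → ℝ≥0∞}, F ≤ F' → Bf F ≤ Bf F' := by
    intro F F' h
    apply lintegral_mono
    intro x
    have := h x
    simp only
    gcongr
  have Bsmul : ∀ (c : ℝ≥0∞) {F : G → ℝ≥0∞}, Measurable F → Bf (c • F) = c ^ 2 * Bf F := by
    intro c F hF
    simp only [hBf]
    rw [← lintegral_const_mul _ (by fun_prop)]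
    congr 1; ext x
    simp only [Pi.smul_apply, smul_eq_mul]; ring
  have Badd : ∀ {F F' : G → ℝ≥0∞}, Measurable F → Measurable F' → Bf (F + F') ≤ 2 * (Bf F + Bf F') := by
    intro F F' h h'
    simp only [hBf]
    rw [← lintegral_add_left (by fun_prop), ← lintegral_const_mul _ (by fun_prop)]
    apply lintegral_mono
    intro x
    simp only [Pi.add_apply, mul_add (w x)]
    exact ennreal_add_sq _ _
  have Bsa : ∀ {F F' : G → ℝ≥0∞}, Measurable F → Measurable F' →
      Bf (κ • (F + F')) ≤ 2 * κ ^ 2 * (Bf F + Bf F') := by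
    intro F F' h h'
    rw [Bsmul _ (by fun_prop)]
    refine (mul_le_mul' le_rfl (Badd h h')).trans (le_of_eq (by ring))
  set Pf := (K * K) * ∏ j, ∫⁻ x, f j x ^ 2 ∂μ with hPf
  let mx : Fin 5 → MFn G := fun j => ⟨X j, mX j⟩
  let mz : Fin 5 → MFn G := fun j => ⟨Z j, mZ j⟩
  have key : ∀ a b z c d : Fin 5, 
      (∏ j, ∫⁻ x, f j x ^ 2 ∂μ) = (∫⁻ x, f a x ^ 2 ∂μ) * (∫⁻ x, f b x ^ 2 ∂μ) * (∫⁻ x, f z x ^ 2 ∂μ) * 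
        (∫⁻ x, f c x ^ 2 ∂μ) * (∫⁻ x, f d x ^ 2 ∂μ) → 
      Bf (mc μ (mc μ (mx a) (mc μ (mx b) (mz z))) (mc μ (mx c) (mx d))).1 ≤ Pf := by
    intro a b z c d h
    rw [hPf, h]
    exact six_term hu hw T (hf a) (hf b) (hf z) (hf c) (hf d) _ _ _ _ _
  have t0 : Bf (((Z 0 ⋆ₗ[μ] X 1) ⋆ₗ[μ] (X 2 ⋆ₗ[μ] X 3)) ⋆ₗ[μ] X 4) ≤ Pf := by
    have h := key 1 4 0 2 3 (by rw [Fin.prod_univ_five]; ring)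
    rwa [show mc μ (mc μ (mx 1) (mc μ (mx 4) (mz 0))) (mc μ (mx 2) (mx 3)) = 
      mc μ (mc μ (mc μ (mz 0) (mx 1)) (mc μ (mx 2) (mx 3))) (mx 4) by ac_rfl] at h
  have t1 : Bf (((X 0 ⋆ₗ[μ] Z 1) ⋆ₗ[μ] (X 2 ⋆ₗ[μ] X 3)) ⋆ₗ[μ] X 4) ≤ Pf := by
    have h := key 0 4 1 2 3 (by rw [Fin.prod_univ_five]; ring)
    rwa [show mc μ (mc μ (mx 0) (mc μ (mx 4) (mz 1))) (mc μ (mx 2) (mx 3)) = 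
      mc μ (mc μ (mc μ (mx 0) (mz 1)) (mc μ (mx 2) (mx 3))) (mx 4) by ac_rfl] at h
  have t2 : Bf (((X 0 ⋆ₗ[μ] X 1) ⋆ₗ[μ] (Z 2 ⋆ₗ[μ] X 3)) ⋆ₗ[μ] X 4) ≤ Pf := by
    have h := key 3 4 2 0 1 (by rw [Fin.prod_univ_five]; ring)
    rwa [show mc μ (mc μ (mx 3) (mc μ (mx 4) (mz 2))) (mc μ (mx 0) (mx 1)) = 
      mc μ (mc μ (mc μ (mx 0) (mx 1)) (mc μ (mz 2) (mx 3))) (mx 4) by ac_rfl] at h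
  have t3 : Bf (((X 0 ⋆ₗ[μ] X 1) ⋆ₗ[μ] (X 2 ⋆ₗ[μ] Z 3)) ⋆ₗ[μ] X 4) ≤ Pf := by
    have h := key 2 4 3 0 1 (by rw [Fin.prod_univ_five]; ring)
    rwa [show mc μ (mc μ (mx 2) (mc μ (mx 4) (mz 3))) (mc μ (mx 0) (mx 1)) = 
      mc μ (mc μ (mc μ (mx 0) (mx 1)) (mc μ (mx 2) (mz 3))) (mx 4) by ac_rfl] at h
  have t4 : Bf (((X 0 ⋆ₗ[μ] X 1) ⋆ₗ[μ] (X 2 ⋆ₗ[μ] X 3)) ⋆ₗ[μ] Z 4) ≤ Pf := by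
    have h := key 2 3 4 0 1 (by rw [Fin.prod_univ_five]; ring)
    rwa [show mc μ (mc μ (mx 2) (mc μ (mx 3) (mz 4))) (mc μ (mx 0) (mx 1)) = 
      mc μ (mc μ (mc μ (mx 0) (mx 1)) (mc μ (mx 2) (mx 3))) (mz 4) by ac_rfl] at h
  refine (Bmono lM).trans ?_
  refine (Bsa (by fun_prop) (by fun_prop)).trans ?_
  rw [smul_conv _ (by fun_prop) (by fun_prop), add_conv (by fun_prop) (by fun_prop)]
  have s1 : Bf (κ • (((κ • (Z 0 ⋆ₗ[μ] X 1 + X 0 ⋆ₗ[μ] Z 1)) ⋆ₗ[μ] (X 2 ⋆ₗ[μ] X 3)) ⋆ₗ[μ] X 4 +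
      ((X 0 ⋆ₗ[μ] X 1) ⋆ₗ[μ] (κ • (Z 2 ⋆ₗ[μ] X 3 + X 2 ⋆ₗ[μ] Z 3))) ⋆ₗ[μ] X 4)) ≤ 
      2 * κ ^ 2 * (2 * κ ^ 2 * (Pf + Pf) + 2 * κ ^ 2 * (Pf + Pf)) := by
    refine (Bsa (by fun_prop) (by fun_prop)).trans ?_
    rw [lconvolution_comm (f := X 0 ⋆ₗ[μ] X 1), smul_conv _ (by fun_prop) (by fun_prop),
      smul_conv _ (by fun_prop) (by fun_prop), add_conv (by fun_prop) (by fun_prop),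
      add_conv (by fun_prop) (by fun_prop), smul_conv _ (by fun_prop) (by fun_prop),
      smul_conv _ (by fun_prop) (by fun_prop), add_conv (by fun_prop) (by fun_prop),
      add_conv (by fun_prop) (by fun_prop), lconvolution_comm (g := X 0 ⋆ₗ[μ] X 1),
      lconvolution_comm (g := X 0 ⋆ₗ[μ] X 1)]
    gcongr
    · refine (Bsa (by fun_prop) (by fun_prop)).trans ?_
      gcongr
    · refine (Bsa (by fun_prop) (by fun_prop)).trans ?_
      gcongr
  refine (mul_le_mul' le_rfl (add_le_add s1 t4)).trans (le_of_eq ?_)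
  rw [hPf]; ring

end conv

noncomputable def nu : Measure (ℤ × ℝ) := (Measure.count : Measure ℤ).prod (volume : Measure ℝ)

instance count_addleft : (Measure.count : Measure ℤ).IsAddLeftInvariant := inferInstance
instance count_neg : (Measure.count : Measure ℤ).IsNegInvariant := by
  constructor
  ext s hs
  rw [Measure.neg_apply, Measure.count_apply (hs.neg), Measure.count_apply hs]
  congr 1
  exact Set.encard_neg s
instance nu_addleft : nu.IsAddLeftInvariant := by unfold nu; infer_instance
instance nu_sigma : SigmaFinite nu := by unfold nu; infer_instance
instance nu_neg : nu.IsNegInvariant := by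
  constructor
  exact ((Measure.measurePreserving_neg (Measure.count : Measure ℤ)).prod
    (Measure.measurePreserving_neg (volume : Measure ℝ))).map_eq

theorem lint_nu {F : ℤ × ℝ → ℝ≥0∞} (hF : Measurable F) :
    ∫⁻ x, F x ∂nu = ∑' k, ∫⁻ η, F (k, η) := by
  unfold nu
  rw [lintegral_prod _ hF.aemeasurable, lintegral_count]

noncomputable def wf (w0 : ℝ → ℝ≥0∞) : ℤ × ℝ → ℝ≥0∞ := fun x => w0 (x.2 + 2 * Real.pi * (x.1:ℝ) ^ 2)
noncomputable def uf (q : ℤ → ℝ≥0∞) (w0 : ℝ → ℝ≥0∞) : ℤ × ℝ → ℝ≥0∞ := fun x =>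
  q x.1 * w0 (x.2 + 2 * Real.pi * (x.1:ℝ) ^ 2)

theorem wf_meas {w0 : ℝ → ℝ≥0∞} (h : Measurable w0) : Measurable (wf w0) := by
  unfold wf
  have : Measurable fun x : ℤ × ℝ => (x.1 : ℝ) := (measurable_from_top (f := fun k : ℤ => (k:ℝ))).comp measurable_fst
  fun_prop
theorem uf_meas {w0 : ℝ → ℝ≥0∞} (q : ℤ → ℝ≥0∞) (h : Measurable w0) : Measurable (uf q w0) := by
  unfold uf
  have h1 : Measurable fun x : ℤ × ℝ => q x.1 := (measurable_from_top (f := q)).comp measurable_fst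
  have := wf_meas h
  exact h1.mul this

noncomputable def shear (f : ℤ × ℝ → ℝ≥0∞) : ℤ → ℝ → ℝ≥0∞ := fun k σ => f (k, σ - 2 * Real.pi * (k:ℝ) ^ 2)

theorem shear_meas {f : ℤ × ℝ → ℝ≥0∞} (hf : Measurable f) (k : ℤ) : Measurable (shear f k) := by
  unfold shear; fun_prop

theorem shear_norm {f : ℤ × ℝ → ℝ≥0∞} (hf : Measurable f) :
    ∫⁻ x, f x ^ 2 ∂nu = ∑' k, ∫⁻ σ, shear f k σ ^ 2 := by
  rw [lint_nu (by fun_prop)]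
  congr 1; ext k
  unfold shear
  exact (lintegral_sub_right_eq_self (fun σ => f (k, σ) ^ 2) _).symm

theorem conv_expand {f1 f2 f3 : ℤ × ℝ → ℝ≥0∞} (q : ℤ → ℝ≥0∞) (hq : ∀ k, q k ≠ ∞) {w0 : ℝ → ℝ≥0∞} (h0 : Measurable w0)
    (h1 : Measurable f1) (h2 : Measurable f2) (h3 : Measurable f3) (k : ℤ) (η : ℝ) :
    ((f1 * uf q w0) ⋆ₗ[nu] ((f2 * uf q w0) ⋆ₗ[nu] (rf (f3 * wf w0)))) (k, η) =
    ∑' p : ℤ × ℤ, q p.1 * q p.2 * Iform w0 (shear f1 p.1) (shear f2 p.2) (shear f3 (p.1 + p.2 - k))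
      ((η + 2 * Real.pi * (k:ℝ) ^ 2) - 4 * Real.pi * ((p.1 - k) * (p.2 - k) : ℤ)) := by
  have mu := uf_meas q h0
  have mw := wf_meas h0
  rw [lconvolution_def, lint_nu (by fun_prop), ENNReal.tsum_prod (f := fun a b => q a * q b *
    Iform w0 (shear f1 a) (shear f2 b) (shear f3 (a + b - k))
      ((η + 2 * Real.pi * (k:ℝ) ^ 2) - 4 * Real.pi * ((a - k) * (b - k) : ℤ)))]
  congr 1; ext k1
  have e1 : ∀ η1 : ℝ, ((f2 * uf q w0) ⋆ₗ[nu] (rf (f3 * wf w0))) (-(k1, η1) + (k, η)) =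
      ∑' k2 : ℤ, ∫⁻ η2 : ℝ, (f2 * uf q w0) (k2, η2) * (f3 * wf w0) (k1 + k2 - k, η1 + η2 - η) := by
    intro η1
    rw [lconvolution_def, lint_nu (by fun_prop)]
    congr 1; ext k2; congr 1; ext η2
    congr 1
    refine congrArg (f3 * wf w0) (Prod.ext ?_ ?_)
    · simp; ring
    · simp; ring
  simp_rw [e1]
  have e2 : ∀ η1, (f1 * uf q w0) (k1, η1) * (∑' k2 : ℤ, ∫⁻ η2 : ℝ, (f2 * uf q w0) (k2, η2) *
      (f3 * wf w0) (k1 + k2 - k, η1 + η2 - η)) = ∑' k2 : ℤ, ∫⁻ η2 : ℝ, (f1 * uf q w0) (k1, η1) *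
        ((f2 * uf q w0) (k2, η2) * (f3 * wf w0) (k1 + k2 - k, η1 + η2 - η)) := by
    intro η1
    rw [← ENNReal.tsum_mul_left]
    congr 1; ext k2
    rw [lintegral_const_mul _ (by fun_prop)]
  simp_rw [e2]
  rw [lintegral_tsum (fun k2 => by fun_prop)]
  congr 1; ext k2
  unfold Iform
  rw [← lintegral_sub_right_eq_self _ (2 * Real.pi * (k1:ℝ) ^ 2), ← lintegral_const_mul' _ _ (ENNReal.mul_ne_top (hq _) (hq _))]
  congr 1; ext σ1
  rw [← lintegral_sub_right_eq_self _ (2 * Real.pi * (k2:ℝ) ^ 2), ← lintegral_const_mul' _ _ (ENNReal.mul_ne_top (hq _) (hq _))]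
  congr 1; ext σ2
  simp only [Pi.mul_apply, uf, wf, shear]
  have ea : σ1 - 2 * Real.pi * (k1:ℝ) ^ 2 + (σ2 - 2 * Real.pi * (k2:ℝ) ^ 2) - η =
      σ1 + σ2 - (η + 2 * Real.pi * (k:ℝ) ^ 2 - 4 * Real.pi * (((k1 - k) * (k2 - k) : ℤ) : ℝ)) - 
        2 * Real.pi * ((k1 + k2 - k : ℤ) : ℝ) ^ 2 := by
    push_cast; ring
  rw [ea]
  simp only [sub_add_cancel]
  ring

theorem concrete_T (s : ℝ) (hs : 0 < s) (ε : ℝ) (hε : 0 < ε) (hε' : ε ≤ 1/22) (hεs : 48 * ε ≤ s) :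
    ∃ K : ℝ≥0∞, K ≠ ∞ ∧ ∀ f1 f2 f3 : ℤ × ℝ → ℝ≥0∞, Measurable f1 → Measurable f2 → Measurable f3 →
      ∫⁻ x, ((f1 * uf (fun k => ENNReal.ofReal (jb k ^ (-s))) (fun σ => ENNReal.ofReal (ja σ ^ (-(1/2 - ε))))) ⋆ₗ[nu] 
        ((f2 * uf (fun k => ENNReal.ofReal (jb k ^ (-s))) (fun σ => ENNReal.ofReal (ja σ ^ (-(1/2 - ε))))) ⋆ₗ[nu]
           (rf (f3 * wf (fun σ => ENNReal.ofReal (ja σ ^ (-(1/2 - ε)))))))) x ^ 2 ∂nu ≤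
        K * ((∫⁻ x, f1 x ^ 2 ∂nu) * (∫⁻ x, f2 x ^ 2 ∂nu) * (∫⁻ x, f3 x ^ 2 ∂nu)) := by
  obtain ⟨CJ, hCJ, hJ⟩ := J3_bound ε hε hε'
  obtain ⟨CS, hCS, hS⟩ := weight_sum s hs ε hε hε' hεs
  set w0 : ℝ → ℝ≥0∞ := fun σ => ENNReal.ofReal (ja σ ^ (-(1/2 - ε))) with hw0
  set q : ℤ → ℝ≥0∞ := fun k => ENNReal.ofReal (jb k ^ (-s)) with hq
  have mw0 : Measurable w0 := by
    have := ja_meas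
    simp only [hw0]; fun_prop
  have hw2 : ∀ σ, w0 σ ^ 2 = ENNReal.ofReal (ja σ ^ (-(1 - 2 * ε))) := by
    intro σ
    simp only [hw0]
    rw [← ENNReal.ofReal_pow (Real.rpow_nonneg (ja_pos _).le _), ← Real.rpow_natCast, ← Real.rpow_mul (ja_pos _).le]
    congr 2; push_cast; ring
  have hq2 : ∀ a b, (q a * q b) ^ 2 = ENNReal.ofReal ((jb a * jb b) ^ (-(2 * s))) := by
    intro a b
    simp only [hq]
    rw [← ENNReal.ofReal_mul (Real.rpow_nonneg (jb_pos _).le _), ← Real.mul_rpow (jb_pos _).le (jb_pos _).le, 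
      ← ENNReal.ofReal_pow (Real.rpow_nonneg (mul_pos (jb_pos _) (jb_pos _)).le _), ← Real.rpow_natCast, 
      ← Real.rpow_mul (mul_pos (jb_pos _) (jb_pos _)).le]
    congr 2; push_cast; ring
  have core := @core_trilinear w0 mw0 q ?_ (fun A => CJ * ENNReal.ofReal (ja A ^ (-(1 - 11 * ε)))) CJ (CJ * CS) ?_ ?_ ?_
  · refine ⟨4 * (CJ * CS + CJ + CJ), ?_, ?_⟩
    · finiteness
    intro f1 f2 f3 h1 h2 h3
    have mu := uf_meas q mw0
    have mw := wf_meas mw0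
    rw [lint_nu (by fun_prop), shear_norm h1, shear_norm h2, shear_norm h3]
    refine le_trans (le_of_eq ?_) (core (shear_meas h1) (shear_meas h2) (shear_meas h3))
    congr 1; ext k
    simp_rw [conv_expand q (fun k => ENNReal.ofReal_ne_top) mw0 h1 h2 h3]
    exact lintegral_add_right_eq_self (fun B : ℝ => (∑' p : ℤ × ℤ, q p.1 * q p.2 * Iform w0 (shear f1 p.1) (shear f2 p.2) 
      (shear f3 (p.1 + p.2 - k)) (B - 4 * Real.pi * ((p.1 - k) * (p.2 - k) : ℤ))) ^ 2) _
  · intro k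
    simp only [hq]
    rw [ENNReal.ofReal_le_one]
    exact Real.rpow_le_one_of_one_le_of_nonpos (jb_ge_one _) (by linarith)
  · intro A
    simp_rw [hw2]
    exact hJ A
  · intro A
    refine mul_le_of_le_one_right zero_le ?_
    rw [ENNReal.ofReal_le_one]
    exact Real.rpow_le_one_of_one_le_of_nonpos (ja_ge_one _) (by linarith)
  · intro k B
    refine le_trans (le_of_eq ?_) (mul_le_mul' (le_refl CJ) (hS k B))
    rw [← ENNReal.tsum_mul_left]
    congr 1; ext p
    rw [hq2]
    split_ifs
    · ring
    · simp

theorem jb_subadd (s : ℝ) (hs : 0 < s) (a b : ℤ) : ENNReal.ofReal (jb (a + b) ^ s) ≤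
    ENNReal.ofReal (2 ^ s) * (ENNReal.ofReal (jb a ^ s) + ENNReal.ofReal (jb b ^ s)) := by
  rw [← ENNReal.ofReal_add (Real.rpow_nonneg (jb_pos _).le _) (Real.rpow_nonneg (jb_pos _).le _),
    ← ENNReal.ofReal_mul (by positivity)]
  apply ENNReal.ofReal_le_ofReal
  have h1 : jb (a + b) ≤ jb a + jb b := by
    unfold jb
    have := abs_add_le (2 * Real.pi * (a:ℝ)) (2 * Real.pi * (b:ℝ))
    push_cast
    rw [mul_add]; linarith
  have h2 : jb a + jb b ≤ 2 * max (jb a) (jb b) := by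
    linarith [le_max_left (jb a) (jb b), le_max_right (jb a) (jb b)]
  calc jb (a + b) ^ s ≤ (2 * max (jb a) (jb b)) ^ s :=
        Real.rpow_le_rpow (jb_pos _).le (h1.trans h2) hs.le
    _ = 2 ^ s * (max (jb a) (jb b)) ^ s := Real.mul_rpow (by norm_num) ((jb_pos a).le.trans (le_max_left _ _))
    _ ≤ _ := by
      gcongr
      have ha := Real.rpow_nonneg (jb_pos a).le s
      have hb := Real.rpow_nonneg (jb_pos b).le s
      rcases max_cases (jb a) (jb b) with h | h <;> rw [h.1] <;> linarith

/-- Fourier-side quintic estimate. -/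
theorem fourier_quintic (s : ℝ) (hs : 0 < s) (ε : ℝ) (hε : 0 < ε) (hε' : ε ≤ 1/22) (hεs : 48 * ε ≤ s) :
    ∃ K : ℝ≥0∞, K ≠ ∞ ∧ ∀ f : Fin 5 → ℤ × ℝ → ℝ≥0∞, (∀ j, Measurable (f j)) → ∀ e : Fin 5 → Bool,
      ∀ u w : ℤ × ℝ → ℝ≥0∞, 
      u = uf (fun k => ENNReal.ofReal (jb k ^ (-s))) (fun σ => ENNReal.ofReal (ja σ ^ (-(1/2 - ε)))) →
      w = wf (fun σ => ENNReal.ofReal (ja σ ^ (-(1/2 - ε)))) → 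
      ∫⁻ x, (w x * (ENNReal.ofReal (jb x.1 ^ s) * (((fl (e 0) (f 0 * u) ⋆ₗ[nu] fl (e 1) (f 1 * u)) ⋆ₗ[nu] 
        (fl (e 2) (f 2 * u) ⋆ₗ[nu] fl (e 3) (f 3 * u))) ⋆ₗ[nu] fl (e 4) (f 4 * u)) x)) ^ 2 ∂nu ≤
      K * ∏ j, ∫⁻ x, f j x ^ 2 ∂nu := by
  obtain ⟨K, hK, T⟩ := concrete_T s hs ε hε hε' hεs
  refine ⟨2 * ENNReal.ofReal (2 ^ s) ^ 2 * (2 * ENNReal.ofReal (2 ^ s) ^ 2 * (2 * ENNReal.ofReal (2 ^ s) ^ 2 * 4) + 1) * (K * K), 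
    by finiteness, ?_⟩
  intro f hf e u w hu hw
  have mw0 : Measurable (fun σ => ENNReal.ofReal (ja σ ^ (-(1/2 - ε)))) := by
    have := ja_meas
    fun_prop
  rw [← hu, ← hw] at T
  have mu : Measurable u := hu ▸ uf_meas _ mw0
  have mw : Measurable w := hw ▸ wf_meas mw0
  refine six_lin (W := fun x : ℤ × ℝ => ENNReal.ofReal (jb x.1 ^ s)) mu mw ?_ ?_ ?_ ?_ T hf e
  · exact (measurable_from_top (f := fun k : ℤ => ENNReal.ofReal (jb k ^ s))).comp measurable_fst
  · intro x
    simp only [hu, hw, uf, wf, Pi.mul_apply]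
    rw [← mul_assoc, ← ENNReal.ofReal_mul (Real.rpow_nonneg (jb_pos _).le _), ← Real.rpow_add (jb_pos _)]
    simp
  · intro x
    simp [jb]
  · intro x y
    exact jb_subadd s hs _ _

open scoped FourierTransform
abbrev TT := AddCircle (1:ℝ)

structure Sm (v : TT → ℝ → ℂ) : Prop where
  smooth : ContDiff ℝ (⊤ : ℕ∞) (fun p : ℝ × ℝ => v ((p.1 : ℝ) : AddCircle (1:ℝ)) p.2)
  supp : ∃ R : ℝ, ∀ (x : AddCircle (1:ℝ)) (t : ℝ), R ≤ |t| → v x t = 0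

theorem Sm.cont {v : TT → ℝ → ℂ} (h : Sm v) : Continuous (fun p : TT × ℝ => v p.1 p.2) := by
  have hq : IsOpenQuotientMap (fun x : ℝ => (x : TT)) := QuotientAddGroup.isOpenQuotientMap_mk
  have h2 := hq.prodMap (IsOpenQuotientMap.id (X := ℝ))
  rw [h2.isQuotientMap.continuous_iff]
  exact h.smooth.continuous

theorem Sm.contx {v : TT → ℝ → ℂ} (h : Sm v) (t : ℝ) : Continuous (fun x => v x t) :=
  h.cont.comp (by fun_prop : Continuous fun x : TT => (x, t))
theorem Sm.contt {v : TT → ℝ → ℂ} (h : Sm v) (x : TT) : Continuous (fun t => v x t) :=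
  h.cont.comp (by fun_prop : Continuous fun t : ℝ => (x, t))

theorem Sm.csupp {v : TT → ℝ → ℂ} (h : Sm v) : HasCompactSupport (fun p : TT × ℝ => v p.1 p.2) := by
  obtain ⟨R, hR⟩ := h.supp
  refine HasCompactSupport.intro (K := Set.univ ×ˢ Set.Icc (-R) R) (isCompact_univ.prod isCompact_Icc) ?_
  rintro ⟨x, t⟩ hx
  apply hR
  by_contra hh
  push Not at hh
  exact hx ⟨trivial, abs_le.mp hh.le⟩

theorem Sm.integrable {v : TT → ℝ → ℂ} (h : Sm v) :
    Integrable (fun p : TT × ℝ => v p.1 p.2) (volume.prod volume) :=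
  h.cont.integrable_of_hasCompactSupport h.csupp

theorem Sm.bdd {v : TT → ℝ → ℂ} (h : Sm v) : ∃ M : ℝ, ∀ x t, ‖v x t‖ ≤ M := by
  obtain ⟨M, hM⟩ := h.csupp.exists_bound_of_continuous h.cont
  exact ⟨M, fun x t => hM (x, t)⟩

noncomputable def ek (k : ℤ) (η : ℝ) (x : TT) (t : ℝ) : ℂ :=
  fourier (-k) x * Complex.exp (-(2 * Real.pi * η * t) * Complex.I)

theorem ek_norm (k : ℤ) (η : ℝ) (x : TT) (t : ℝ) : ‖ek k η x t‖ = 1 := by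
  unfold ek
  rw [norm_mul]
  have h1 : ‖(fourier (-k) x : ℂ)‖ = 1 := Circle.norm_coe _
  have h2 : ‖Complex.exp (-(2 * Real.pi * η * t) * Complex.I)‖ = 1 := by
    have : (-(2 * Real.pi * η * t) * Complex.I : ℂ) = ((-(2 * Real.pi * η * t) : ℝ) : ℂ) * Complex.I := by
      push_cast; ring
    rw [this]; exact Complex.norm_exp_ofReal_mul_I _
  rw [h1, h2, one_mul]

theorem ek_cont (k : ℤ) (η : ℝ) : Continuous (fun p : TT × ℝ => ek k η p.1 p.2) := by
  unfold ek; fun_prop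

theorem FT_int {v : TT → ℝ → ℂ} (h : Integrable (fun p : TT × ℝ => v p.1 p.2) (volume.prod volume)) (k : ℤ) (η : ℝ) :
    Integrable (fun p : TT × ℝ => v p.1 p.2 * ek k η p.1 p.2) (volume.prod volume) := by
  refine h.mul_bdd (c := 1) (ek_cont k η).aestronglyMeasurable ?_
  exact Filter.Eventually.of_forall fun p => (ek_norm _ _ _ _).le

theorem FT_eq {v : TT → ℝ → ℂ} (h : Integrable (fun p : TT × ℝ => v p.1 p.2) (volume.prod volume)) (k : ℤ) (η : ℝ) :
    spacetimeFT v k η = ∫ p : TT × ℝ, v p.1 p.2 * ek k η p.1 p.2 ∂(volume.prod volume) := by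
  rw [integral_prod_symm _ (FT_int h k η)]
  unfold spacetimeFT ek
  simp only [mul_assoc]

theorem FT_eq' {v : TT → ℝ → ℂ} (h : Integrable (fun p : TT × ℝ => v p.1 p.2) (volume.prod volume)) (k : ℤ) (η : ℝ) :
    spacetimeFT v k η = ∫ x : TT, ∫ t : ℝ, v x t * ek k η x t := by
  rw [FT_eq h, integral_prod _ (FT_int h k η)]

theorem FT_bdd {v : TT → ℝ → ℂ} (h : Integrable (fun p : TT × ℝ => v p.1 p.2) (volume.prod volume)) (k : ℤ) (η : ℝ) :
    ‖spacetimeFT v k η‖ ≤ ∫ p : TT × ℝ, ‖v p.1 p.2‖ ∂(volume.prod volume) := by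
  rw [FT_eq h]
  refine (norm_integral_le_integral_norm _).trans (le_of_eq ?_)
  congr 1; ext p
  rw [norm_mul, ek_norm, mul_one]

noncomputable def Dt (v : TT → ℝ → ℂ) (x : TT) (t : ℝ) : ℂ := deriv (v x) t
noncomputable def Dx (v : TT → ℝ → ℂ) (x : TT) (t : ℝ) : ℂ := deriv (fun h : ℝ => v (x + (h:TT)) t) 0

theorem Sm.hasDt {v : TT → ℝ → ℂ} (h : Sm v) (x : ℝ) (t : ℝ) :
    HasDerivAt (v (x:TT)) (fderiv ℝ (fun p : ℝ × ℝ => v ((p.1 : ℝ) : AddCircle (1:ℝ)) p.2) (x, t) (0, 1)) t := by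
  have h1 : HasFDerivAt (fun p : ℝ × ℝ => v ((p.1 : ℝ) : AddCircle (1:ℝ)) p.2) _ (x, t) :=
    (h.smooth.differentiable (by simp) (x, t)).hasFDerivAt
  have h2 : HasDerivAt (fun t : ℝ => (x, t)) ((0:ℝ), (1:ℝ)) t := (hasDerivAt_const t x).prodMk (hasDerivAt_id t)
  exact h1.comp_hasDerivAt t h2

theorem Sm.hasDx {v : TT → ℝ → ℂ} (h : Sm v) (x : ℝ) (t : ℝ) :
    HasDerivAt (fun x : ℝ => v (x:TT) t) (fderiv ℝ (fun p : ℝ × ℝ => v ((p.1 : ℝ) : AddCircle (1:ℝ)) p.2) (x, t) (1, 0)) x := by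
  have h1 : HasFDerivAt (fun p : ℝ × ℝ => v ((p.1 : ℝ) : AddCircle (1:ℝ)) p.2) _ (x, t) :=
    (h.smooth.differentiable (by simp) (x, t)).hasFDerivAt
  have h2 : HasDerivAt (fun x : ℝ => (x, t)) ((1:ℝ), (0:ℝ)) x := (hasDerivAt_id x).prodMk (hasDerivAt_const x t)
  exact h1.comp_hasDerivAt x h2

theorem Sm.Dx_eq {v : TT → ℝ → ℂ} (h : Sm v) (x : ℝ) (t : ℝ) :
    Dx v (x:TT) t = fderiv ℝ (fun p : ℝ × ℝ => v ((p.1 : ℝ) : AddCircle (1:ℝ)) p.2) (x, t) (1, 0) := by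
  unfold Dx
  have h1 := h.hasDx x t
  have h2 : HasDerivAt (fun y : ℝ => x + y) 1 0 := by simpa using (hasDerivAt_id (0:ℝ)).const_add x
  have h3 := HasDerivAt.scomp (0:ℝ) (h := fun y : ℝ => x + y) (by simpa using h1) h2
  have := h3.deriv
  simp only [one_smul] at this
  rw [← this]
  congr 1

theorem Sm.Dt {v : TT → ℝ → ℂ} (h : Sm v) : Sm (Dt v) := by
  refine ⟨?_, ?_⟩
  · have : (fun p : ℝ × ℝ => _root_.Dt v ((p.1 : ℝ) : AddCircle (1:ℝ)) p.2) = 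
      fun p => fderiv ℝ (fun p : ℝ × ℝ => v ((p.1 : ℝ) : AddCircle (1:ℝ)) p.2) p (0, 1) := by
      ext p
      exact (h.hasDt p.1 p.2).deriv
    rw [this]
    exact (h.smooth.fderiv_right (by simp)).clm_apply contDiff_const
  · obtain ⟨R, hR⟩ := h.supp
    refine ⟨R + 1, fun x t ht => ?_⟩
    unfold _root_.Dt
    have : v x =ᶠ[nhds t] fun _ => 0 := by
      have : ∀ᶠ y in nhds t, R < |y| := continuous_abs.continuousAt.eventually_const_lt (by linarith)
      filter_upwards [this] with y hy using hR x y hy.le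
    rw [this.deriv_eq]; simp

theorem Sm.Dx {v : TT → ℝ → ℂ} (h : Sm v) : Sm (Dx v) := by
  refine ⟨?_, ?_⟩
  · have : (fun p : ℝ × ℝ => _root_.Dx v ((p.1 : ℝ) : AddCircle (1:ℝ)) p.2) = 
      fun p => fderiv ℝ (fun p : ℝ × ℝ => v ((p.1 : ℝ) : AddCircle (1:ℝ)) p.2) p (1, 0) := by
      ext p
      exact h.Dx_eq p.1 p.2
    rw [this]
    exact (h.smooth.fderiv_right (by simp)).clm_apply contDiff_const
  · obtain ⟨R, hR⟩ := h.supp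
    refine ⟨R, fun x t ht => ?_⟩
    unfold _root_.Dx
    simp [hR _ t ht]

theorem FT_Dt {v : TT → ℝ → ℂ} (h : Sm v) (k : ℤ) (η : ℝ) :
    spacetimeFT (Dt v) k η = (2 * Real.pi * Complex.I * η) * spacetimeFT v k η := by
  rw [FT_eq' h.integrable, FT_eq' h.Dt.integrable, ← integral_const_mul]
  congr 1; ext x
  have hex : ∀ g : ℝ → ℂ, ∫ t, g t * ek k η x t = fourier (-k) x * 𝓕 g η := by
    intro g
    rw [Real.fourier_real_eq_integral_exp_smul, ← integral_const_mul]
    congr 1; ext t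
    unfold ek
    rw [smul_eq_mul]
    have : ((-2 * Real.pi * t * η : ℝ) : ℂ) * Complex.I = (-(2 * Real.pi * η * t) * Complex.I : ℂ) := by
      push_cast; ring
    rw [this]; ring
  have hc : ∀ {u : TT → ℝ → ℂ}, Sm u → Integrable (u x) := by
    intro u hu
    refine (hu.contt x).integrable_of_hasCompactSupport ?_
    obtain ⟨R, hR⟩ := hu.supp
    refine HasCompactSupport.intro (K := Set.Icc (-R) R) isCompact_Icc ?_
    intro t ht
    apply hR
    by_contra hh
    push Not at hh
    exact ht (abs_le.mp hh.le)
  rw [hex, hex]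
  have hd : Differentiable ℝ (v x) := by
    obtain ⟨y, rfl⟩ := QuotientAddGroup.mk_surjective x
    exact fun t => (h.hasDt y t).differentiableAt
  have hDt : Dt v x = deriv (v x) := rfl
  have := congrFun (Real.fourier_deriv (hc h) hd (hc h.Dt)) η
  rw [hDt, this]
  simp only [smul_eq_mul]
  ring

theorem FT_Dx {v : TT → ℝ → ℂ} (h : Sm v) (k : ℤ) (η : ℝ) :
    spacetimeFT (Dx v) k η = (2 * Real.pi * Complex.I * k) * spacetimeFT v k η := by
  unfold spacetimeFT
  rw [← integral_const_mul]
  congr 1; ext t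
  rw [integral_mul_const, integral_mul_const, ← mul_assoc]
  congr 1
  have hpre : ∀ g : TT → ℂ, ∫ x : TT, g x = ∫ x in (0:ℝ)..1, g (x:TT) := by
    intro g
    have := AddCircle.intervalIntegral_preimage (1:ℝ) 0 g
    rw [zero_add] at this
    exact this.symm
  rw [hpre, hpre, ← sub_eq_zero, ← intervalIntegral.integral_const_mul, ← intervalIntegral.integral_sub]
  · have hd : ∀ x : ℝ, HasDerivAt (fun x : ℝ => v (x:TT) t * fourier (-k) (x:TT))
      (Dx v (x:TT) t * fourier (-k) (x:TT) - (2 * Real.pi * Complex.I * k) * (v (x:TT) t * fourier (-k) (x:TT))) x := by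
      intro x
      have h1 := h.hasDx x t
      rw [← h.Dx_eq] at h1
      have h2 := hasDerivAt_fourier_neg (1:ℝ) k x
      refine (h1.mul h2).congr_deriv ?_
      push_cast
      ring
    rw [intervalIntegral.integral_eq_sub_of_hasDerivAt (fun x _ => hd x)]
    · have : ((1:ℝ):TT) = ((0:ℝ):TT) := by simpa using AddCircle.coe_period (1:ℝ)
      rw [this, sub_self]
    · apply Continuous.intervalIntegrable
      have h1 := (h.contx t).comp (AddCircle.continuous_mk' (1:ℝ))
      have h2 := (h.Dx.contx t).comp (AddCircle.continuous_mk' (1:ℝ))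
      have h3 := (map_continuous (fourier (T := 1) (-k))).comp (AddCircle.continuous_mk' (1:ℝ))
      exact (h2.mul h3).sub (continuous_const.mul (h1.mul h3))
  · apply Continuous.intervalIntegrable
    have h2 := (h.Dx.contx t).comp (AddCircle.continuous_mk' (1:ℝ))
    have h3 := (map_continuous (fourier (T := 1) (-k))).comp (AddCircle.continuous_mk' (1:ℝ))
    exact h2.mul h3
  · apply Continuous.intervalIntegrable
    have h1 := (h.contx t).comp (AddCircle.continuous_mk' (1:ℝ))
    have h3 := (map_continuous (fourier (T := 1) (-k))).comp (AddCircle.continuous_mk' (1:ℝ))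
    exact (continuous_const.mul (h1.mul h3))

theorem FT_decay {v : TT → ℝ → ℂ} (h : Sm v) : ∃ M : ℝ, ∀ (k : ℤ) (η : ℝ),
    ‖spacetimeFT v k η‖ ≤ M * (1 + (k:ℝ) ^ 2)⁻¹ * (1 + η ^ 2)⁻¹ := by
  have h1 : ∀ {v : TT → ℝ → ℂ}, Sm v → ∃ M : ℝ, ∀ (k : ℤ) (η : ℝ), ‖spacetimeFT v k η‖ * (1 + η ^ 2) ≤ M := by
    intro v h
    refine ⟨(∫ p : TT × ℝ, ‖v p.1 p.2‖ ∂(volume.prod volume)) + ∫ p : TT × ℝ, ‖Dt (Dt v) p.1 p.2‖ ∂(volume.prod volume), fun k η => ?_⟩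
    have a := FT_bdd h.integrable k η
    have b := FT_bdd h.Dt.Dt.integrable k η
    rw [FT_Dt h.Dt, FT_Dt h] at b
    simp only [norm_mul, Complex.norm_I, Complex.norm_real, Complex.norm_ofNat, Real.norm_eq_abs] at b
    have hpi : 1 ≤ |Real.pi| := by rw [abs_of_pos Real.pi_pos]; linarith [Real.pi_gt_three]
    have e : ‖spacetimeFT v k η‖ * η ^ 2 ≤ 2 * |Real.pi| * 1 * |η| * (2 * |Real.pi| * 1 * |η| * ‖spacetimeFT v k η‖) := by
      have : 2 * |Real.pi| * 1 * |η| * (2 * |Real.pi| * 1 * |η| * ‖spacetimeFT v k η‖) = 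
        (4 * |Real.pi| ^ 2) * (‖spacetimeFT v k η‖ * η ^ 2) := by rw [← sq_abs η]; ring
      rw [this]
      refine le_mul_of_one_le_left (by positivity) (by nlinarith)
    calc _ = ‖spacetimeFT v k η‖ + ‖spacetimeFT v k η‖ * η ^ 2 := by ring
      _ ≤ _ := add_le_add a (e.trans b)
  obtain ⟨M1, hM1⟩ := h1 h
  obtain ⟨M2, hM2⟩ := h1 h.Dx.Dx
  refine ⟨M1 + M2, fun k η => ?_⟩
  have a := hM1 k η
  have b := hM2 k η
  rw [FT_Dx h.Dx, FT_Dx h] at b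
  simp only [norm_mul, Complex.norm_I, Complex.norm_real, Complex.norm_ofNat, Real.norm_eq_abs, Complex.norm_intCast] at b
  have hpi : 1 ≤ |Real.pi| := by rw [abs_of_pos Real.pi_pos]; linarith [Real.pi_gt_three]
  have e : (k:ℝ) ^ 2 * (‖spacetimeFT v k η‖ * (1 + η ^ 2)) ≤ 
      2 * |Real.pi| * 1 * |(k:ℝ)| * (2 * |Real.pi| * 1 * |(k:ℝ)| * ‖spacetimeFT v k η‖) * (1 + η ^ 2) := by
    have : 2 * |Real.pi| * 1 * |(k:ℝ)| * (2 * |Real.pi| * 1 * |(k:ℝ)| * ‖spacetimeFT v k η‖) * (1 + η ^ 2) = 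
      (4 * |Real.pi| ^ 2) * ((k:ℝ) ^ 2 * (‖spacetimeFT v k η‖ * (1 + η ^ 2))) := by rw [← sq_abs (k:ℝ)]; ring
    rw [this]
    refine le_mul_of_one_le_left (by positivity) (by nlinarith)
  have e2 : ‖spacetimeFT v k η‖ * (1 + η ^ 2) * (1 + (k:ℝ) ^ 2) ≤ M1 + M2 := by nlinarith
  rw [← div_eq_mul_inv, ← div_eq_mul_inv, le_div_iff₀ (by positivity), le_div_iff₀ (by positivity)]
  exact e2

theorem FT_cont {v : TT → ℝ → ℂ} (h : Integrable (fun p : TT × ℝ => v p.1 p.2) (volume.prod volume)) (k : ℤ) :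
    Continuous (fun η => spacetimeFT v k η) := by
  simp_rw [FT_eq h]
  refine continuous_of_dominated (bound := fun p : TT × ℝ => ‖v p.1 p.2‖) ?_ ?_ h.norm ?_
  · exact fun η => (FT_int h k η).aestronglyMeasurable
  · intro η
    refine Filter.Eventually.of_forall fun p => ?_
    rw [norm_mul, ek_norm, mul_one]
  · refine Filter.Eventually.of_forall fun p => ?_
    unfold ek
    fun_prop

theorem FT_meas {v : TT → ℝ → ℂ} (h : Integrable (fun p : TT × ℝ => v p.1 p.2) (volume.prod volume)) :
    Measurable (fun ξ : ℤ × ℝ => spacetimeFT v ξ.1 ξ.2) :=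
  measurable_from_prod_countable_right fun k => (FT_cont h k).measurable

theorem FT_integrable {v : TT → ℝ → ℂ} (h : Sm v) :
    Integrable (fun ξ : ℤ × ℝ => spacetimeFT v ξ.1 ξ.2) nu := by
  obtain ⟨M, hM⟩ := FT_decay h
  have h1 : Integrable (fun k : ℤ => M * (1 + (k:ℝ) ^ 2)⁻¹) Measure.count := by
    rw [integrable_count_iff]
    apply Summable.norm
    apply Summable.mul_left
    have hs : Summable fun k : ℤ => (|(k:ℝ)| ^ (2:ℝ))⁻¹ := by
      simpa [Real.rpow_neg] using Real.summable_abs_int_rpow (b := 2) (by norm_num)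
    refine Summable.of_norm_bounded_eventually hs ?_
    have : ∀ᶠ k : ℤ in Filter.cofinite, k ≠ 0 := Set.Finite.compl_mem_cofinite (Set.finite_singleton 0)
    filter_upwards [this] with k hk
    have hk' : (0:ℝ) < (k:ℝ) ^ 2 := by positivity
    rw [Real.norm_of_nonneg (by positivity), Real.rpow_two, sq_abs]
    gcongr
    linarith
  have h2 : Integrable (fun η : ℝ => (1 + η ^ 2)⁻¹) := integrable_inv_one_add_sq
  refine (h1.mul_prod h2).mono' (FT_meas h.integrable).aestronglyMeasurable ?_
  exact Filter.Eventually.of_forall fun ξ => hM ξ.1 ξ.2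

theorem haar_vol : (AddCircle.haarAddCircle : Measure TT) = volume := by
  rw [AddCircle.volume_eq_smul_haarAddCircle]; simp

theorem integral_nu {F : ℤ × ℝ → ℂ} (hF : Integrable F nu) :
    ∫ ξ, F ξ ∂nu = ∑' k : ℤ, ∫ η : ℝ, F (k, η) := by
  unfold nu at hF ⊢
  rw [integral_prod _ hF, integral_countable hF.integral_prod_left]
  simp [measureReal_def]

theorem ek_joint : Continuous (fun z : (ℤ × ℝ) × (TT × ℝ) => ek z.1.1 z.1.2 z.2.1 z.2.2) := by
  unfold ek
  simp only [fourier_apply]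
  have : Continuous fun z : (ℤ × ℝ) × (TT × ℝ) => (-z.1.1) • z.2.1 := by fun_prop
  have h2 := AddCircle.continuous_toCircle (T := (1:ℝ)) |>.comp this
  exact (continuous_induced_dom.comp h2).mul (by fun_prop)

theorem ek_joint_comp {α : Type*} [TopologicalSpace α] {a : α → ℤ} {b : α → ℝ} {c : α → TT} {d : α → ℝ}
    (ha : Continuous a) (hb : Continuous b) (hc : Continuous c) (hd : Continuous d) :
    Continuous fun z => ek (a z) (b z) (c z) (d z) :=
  ek_joint.comp ((ha.prodMk hb).prodMk (hc.prodMk hd))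

theorem ek_mul (k l : ℤ) (η θ : ℝ) (x : TT) (t : ℝ) : ek k η x t * ek l θ x t = ek (k + l) (η + θ) x t := by
  unfold ek
  rw [neg_add, fourier_add, mul_mul_mul_comm, ← Complex.exp_add]
  congr 2
  push_cast; ring

theorem ek_conj (k : ℤ) (η : ℝ) (x : TT) (t : ℝ) : (starRingEnd ℂ) (ek k η x t) = ek (-k) (-η) x t := by
  unfold ek
  rw [map_mul, ← Complex.exp_conj, fourier_neg (n := -k)]
  congr 2
  simp only [map_mul, map_neg, Complex.conj_I, Complex.conj_ofReal, Complex.conj_ofNat]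
  push_cast; ring

theorem inversion {v : TT → ℝ → ℂ} (h : Sm v) (x : TT) (t : ℝ) :
    v x t = ∫ ξ : ℤ × ℝ, spacetimeFT v ξ.1 ξ.2 * ek (-ξ.1) (-ξ.2) x t ∂nu := by
  obtain ⟨D, hD⟩ := FT_decay h
  obtain ⟨M, hM⟩ := h.bdd
  have hI := FT_integrable h
  have hI2 : Integrable (fun ξ : ℤ × ℝ => spacetimeFT v ξ.1 ξ.2 * ek (-ξ.1) (-ξ.2) x t) nu := by
    refine hI.mul_bdd (c := 1) ?_ ?_
    · have : Continuous fun ξ : ℤ × ℝ => ek (-ξ.1) (-ξ.2) x t :=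
        ek_joint_comp (by fun_prop) (by fun_prop) (by fun_prop) (by fun_prop)
      exact this.aestronglyMeasurable
    · exact Filter.Eventually.of_forall fun p => (ek_norm _ _ _ _).le
  rw [integral_nu hI2]
  set a : ℤ → ℝ → ℂ := fun k t => ∫ x, v x t * fourier (-k) x with ha
  have hac : ∀ k, Continuous (a k) := by
    intro k
    refine continuous_of_dominated (bound := fun _ : TT => M) ?_ ?_ (integrable_const _) ?_
    · intro t
      exact ((h.contx t).mul (map_continuous _)).aestronglyMeasurable
    · intro t
      refine Filter.Eventually.of_forall fun x => ?_
      rw [norm_mul]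
      have : ‖(fourier (-k) x : ℂ)‖ = 1 := Circle.norm_coe _
      rw [this, mul_one]; exact hM x t
    · exact Filter.Eventually.of_forall fun x => (h.contt x).mul continuous_const
  have hai : ∀ k, Integrable (a k) := by
    intro k
    refine (hac k).integrable_of_hasCompactSupport ?_
    obtain ⟨R, hR⟩ := h.supp
    refine HasCompactSupport.intro (K := Set.Icc (-R) R) isCompact_Icc ?_
    intro t ht
    have : ∀ x, v x t = 0 := by
      intro x
      apply hR
      by_contra hh
      push Not at hh
      exact ht (abs_le.mp hh.le)
    simp [ha, this]
  have hFT : ∀ k, 𝓕 (a k) = fun η => spacetimeFT v k η := by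
    intro k; ext η
    rw [Real.fourier_real_eq_integral_exp_smul]
    unfold spacetimeFT
    congr 1; ext t
    rw [integral_mul_const, smul_eq_mul, mul_comm]
    congr 2
    push_cast; ring
  have hFi : ∀ k, Integrable (fun η => spacetimeFT v k η) := by
    intro k
    refine (integrable_inv_one_add_sq.const_mul (D * (1 + (k:ℝ) ^ 2)⁻¹)).mono' (FT_cont h.integrable k).aestronglyMeasurable ?_
    exact Filter.Eventually.of_forall fun η => hD k η
  have hinv : ∀ k, a k t = ∫ η, spacetimeFT v k η * Complex.exp ((2 * Real.pi * η * t) * Complex.I) := by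
    intro k
    have := congrFun ((hac k).fourierInv_fourier_eq (hai k) (by rw [hFT]; exact hFi k)) t
    rw [← this, hFT, Real.fourierInv_eq']
    congr 1; ext η
    rw [smul_eq_mul, mul_comm]
    congr 2
    simp only [RCLike.inner_apply, conj_trivial]
    push_cast; ring
  have hcoef : ∀ k, fourierCoeff (fun x => v x t) k = a k t := by
    intro k
    unfold fourierCoeff
    rw [haar_vol]
    simp only [ha, smul_eq_mul, mul_comm]
  have hterm : ∀ k, ∫ η : ℝ, spacetimeFT v k η * ek (-k) (-η) x t = a k t * fourier k x := by
    intro k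
    rw [hinv, ← integral_mul_const]
    congr 1; ext η
    unfold ek
    rw [neg_neg]
    have : (-(2 * Real.pi * ((-η : ℝ) : ℂ) * t) * Complex.I : ℂ) = (2 * Real.pi * η * t) * Complex.I := by push_cast; ring
    rw [this]; ring
  simp_rw [hterm]
  have hsum : Summable (fun k => a k t) := by
    have h1 : Integrable (fun k : ℤ => ∫ η : ℝ, ‖spacetimeFT v k η‖) Measure.count := by
      have := hI
      unfold nu at this
      exact this.norm.integral_prod_left
    rw [integrable_count_iff] at h1
    refine Summable.of_norm_bounded h1 ?_
    intro k
    rw [hinv]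
    refine (norm_integral_le_integral_norm _).trans ?_
    rw [Real.norm_of_nonneg (by positivity)]
    apply le_of_eq
    congr 1; ext η
    rw [norm_mul]
    have : (2 * Real.pi * η * t * Complex.I : ℂ) = ((2 * Real.pi * η * t : ℝ) : ℂ) * Complex.I := by push_cast; ring
    rw [this, Complex.norm_exp_ofReal_mul_I, mul_one]
  have := has_pointwise_sum_fourier_series_of_summable (f := ⟨fun x => v x t, h.contx t⟩) 
    (by convert hsum using 2; exact hcoef _) x
  rw [← show (⟨fun x => v x t, h.contx t⟩ : C(TT, ℂ)) x = v x t from rfl, ← this.tsum_eq]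
  congr 1; ext k
  rw [smul_eq_mul, ← hcoef]
  rfl

noncomputable def AF (v : TT → ℝ → ℂ) : ℤ × ℝ → ℝ≥0∞ := fun ξ => ‖spacetimeFT v ξ.1 ξ.2‖ₑ

theorem FT_mul_le {g v : TT → ℝ → ℂ} {U : ℤ × ℝ → ℂ}
    (hg : Integrable (fun p : TT × ℝ => g p.1 p.2) (volume.prod volume)) (hU : Integrable U nu)
    (hvc : Continuous (fun p : TT × ℝ => v p.1 p.2))
    (hv : ∀ x t, v x t = ∫ ξ, U ξ * ek (-ξ.1) (-ξ.2) x t ∂nu) :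
    Integrable (fun p : TT × ℝ => g p.1 p.2 * v p.1 p.2) (volume.prod volume) ∧
    AF (fun x t => g x t * v x t) ≤ (fun ξ => ‖U ξ‖ₑ) ⋆ₗ[nu] AF g := by
  have hint : Integrable (fun p : TT × ℝ => g p.1 p.2 * v p.1 p.2) (volume.prod volume) := by
    refine hg.mul_bdd (c := ∫ ξ, ‖U ξ‖ ∂nu) hvc.aestronglyMeasurable ?_
    refine Filter.Eventually.of_forall fun p => ?_
    rw [hv]
    refine (norm_integral_le_integral_norm _).trans (le_of_eq ?_)
    congr 1; ext ξ
    rw [norm_mul, ek_norm, mul_one]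
  refine ⟨hint, ?_⟩
  rintro ⟨k, η⟩
  have e : spacetimeFT (fun x t => g x t * v x t) k η = 
      ∫ ξ, U ξ * spacetimeFT g (-ξ.1 + k) (-ξ.2 + η) ∂nu := by
    rw [FT_eq hint]
    have e1 : ∀ p : TT × ℝ, g p.1 p.2 * v p.1 p.2 * ek k η p.1 p.2 = 
        ∫ ξ, g p.1 p.2 * U ξ * ek (-ξ.1 + k) (-ξ.2 + η) p.1 p.2 ∂nu := by
      intro p
      rw [hv, ← integral_const_mul, ← integral_mul_const]
      congr 1; ext ξ
      rw [← ek_mul]; ring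
    simp_rw [e1]
    rw [integral_integral_swap]
    · congr 1; ext ξ
      rw [FT_eq hg, ← integral_const_mul]
      congr 1; ext p
      ring
    · refine (hg.mul_prod hU).mul_bdd (c := 1) ?_ ?_
      · have : Continuous fun z : (TT × ℝ) × (ℤ × ℝ) => ek (-z.2.1 + k) (-z.2.2 + η) z.1.1 z.1.2 :=
          ek_joint_comp (by fun_prop) (by fun_prop) (by fun_prop) (by fun_prop)
        exact this.aestronglyMeasurable
      · exact Filter.Eventually.of_forall fun p => (ek_norm _ _ _ _).le
  unfold AF
  simp only [lconvolution_def]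
  rw [e]
  refine (enorm_integral_le_lintegral_enorm _).trans (le_of_eq ?_)
  congr 1; ext ξ
  rw [enorm_mul]; rfl

theorem FT_mul_sm {g v : TT → ℝ → ℂ} (hg : Integrable (fun p : TT × ℝ => g p.1 p.2) (volume.prod volume)) (hv : Sm v) :
    Integrable (fun p : TT × ℝ => g p.1 p.2 * v p.1 p.2) (volume.prod volume) ∧
    AF (fun x t => g x t * v x t) ≤ AF v ⋆ₗ[nu] AF g :=
  FT_mul_le hg (FT_integrable hv) hv.cont (inversion hv)

theorem FT_mul_conj {g v : TT → ℝ → ℂ} (hg : Integrable (fun p : TT × ℝ => g p.1 p.2) (volume.prod volume)) (hv : Sm v) :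
    Integrable (fun p : TT × ℝ => g p.1 p.2 * (starRingEnd ℂ) (v p.1 p.2)) (volume.prod volume) ∧
    AF (fun x t => g x t * (starRingEnd ℂ) (v x t)) ≤ rf (AF v) ⋆ₗ[nu] AF g := by
  have hU : Integrable (fun ξ : ℤ × ℝ => (starRingEnd ℂ) (spacetimeFT v (-ξ).1 (-ξ).2)) nu := by
    have h1 := (FT_integrable hv).comp_neg
    exact (Complex.conjCLE.toContinuousLinearMap).integrable_comp h1
  have := FT_mul_le (v := fun x t => (starRingEnd ℂ) (v x t)) hg hU
    (Complex.continuous_conj.comp hv.cont) ?_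
  · refine ⟨this.1, this.2.trans (le_of_eq ?_)⟩
    congr 1
    ext ξ
    simp only [rf, AF]
    rw [← ofReal_norm, ← ofReal_norm, RCLike.norm_conj]
  · intro x t
    rw [inversion hv x t, ← integral_conj, ← integral_neg_eq_self]
    congr 1; ext ξ
    rw [map_mul, ek_conj]
    simp

theorem FT_conv {g : TT → ℝ → ℂ} {w : TT → ℂ} (hw : Integrable w)
    (hg : Integrable (fun p : TT × ℝ => g p.1 p.2) (volume.prod volume)) :
    Integrable (fun p : TT × ℝ => ∫ z, w (p.1 - z) * g z p.2) (volume.prod volume) ∧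
    AF (fun x t => ∫ z, w (x - z) * g z t) ≤ (∫⁻ x, ‖w x‖ₑ) • AF g := by
  have mp : MeasurePreserving (fun q : (TT × ℝ) × TT => (q.1, q.2 - q.1.1)) 
      (((volume : Measure TT).prod (volume : Measure ℝ)).prod (volume : Measure TT)) 
      (((volume : Measure TT).prod (volume : Measure ℝ)).prod (volume : Measure TT)) := by
    refine MeasurePreserving.skew_product (g := fun (p : TT × ℝ) y => y - p.1) (MeasurePreserving.id _) (by fun_prop) ?_
    exact Filter.Eventually.of_forall fun p => (measurePreserving_sub_right volume p.1).map_eq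
  have mp2 : MeasurePreserving (fun q : (TT × ℝ) × TT => ((q.2, q.1.2), q.1.1))
      (((volume : Measure TT).prod (volume : Measure ℝ)).prod (volume : Measure TT)) 
      (((volume : Measure TT).prod (volume : Measure ℝ)).prod (volume : Measure TT)) := by
    have a1 := measurePreserving_prodAssoc (volume : Measure TT) (volume : Measure ℝ) (volume : Measure TT)
    have a2 := (MeasurePreserving.id (volume : Measure TT)).prod (Measure.measurePreserving_swap (μ := (volume : Measure ℝ)) (ν := (volume : Measure TT)))
    have a3 := Measure.measurePreserving_swap (μ := (volume : Measure TT)) (ν := ((volume : Measure TT).prod (volume : Measure ℝ)))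
    exact a3.comp (a2.comp a1)
  have hK0 : Integrable (fun q : (TT × ℝ) × TT => g q.1.1 q.1.2 * w (q.2 - q.1.1)) 
      (((volume : Measure TT).prod (volume : Measure ℝ)).prod (volume : Measure TT)) :=
    mp.integrable_comp_of_integrable (hg.mul_prod hw)
  have hK1 : Integrable (fun q : (TT × ℝ) × TT => w (q.1.1 - q.2) * g q.2 q.1.2) 
      (((volume : Measure TT).prod (volume : Measure ℝ)).prod (volume : Measure TT)) := by
    have := mp2.integrable_comp_of_integrable hK0
    refine this.congr (Filter.Eventually.of_forall fun q => ?_)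
    simp only [Function.comp]
    ring
  have hint := hK1.integral_prod_left
  refine ⟨hint, ?_⟩
  rintro ⟨k, η⟩
  have ebdd : Integrable (fun q : (TT × ℝ) × TT => g q.1.1 q.1.2 * w (q.2 - q.1.1) * ek k η q.2 q.1.2) 
      (((volume : Measure TT).prod (volume : Measure ℝ)).prod (volume : Measure TT)) := by
    refine hK0.mul_bdd (c := 1) ?_ (Filter.Eventually.of_forall fun p => (ek_norm _ _ _ _).le)
    exact ((ek_cont k η).comp (by fun_prop : Continuous fun q : (TT × ℝ) × TT => (q.2, q.1.2))).aestronglyMeasurable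
  have ebdd1 : Integrable (fun q : (TT × ℝ) × TT => w (q.1.1 - q.2) * g q.2 q.1.2 * ek k η q.1.1 q.1.2) 
      (((volume : Measure TT).prod (volume : Measure ℝ)).prod (volume : Measure TT)) := by
    refine hK1.mul_bdd (c := 1) ?_ (Filter.Eventually.of_forall fun p => (ek_norm _ _ _ _).le)
    exact ((ek_cont k η).comp (by fun_prop : Continuous fun q : (TT × ℝ) × TT => (q.1.1, q.1.2))).aestronglyMeasurable
  have e : spacetimeFT (fun x t => ∫ z, w (x - z) * g z t) k η = 
      (∫ x, w x * fourier (-k) x) * spacetimeFT g k η := by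
    generalize hcc : (∫ x, w x * fourier (-k) x) = cc
    rw [FT_eq hint, FT_eq hg]
    simp_rw [← integral_mul_const]
    rw [← integral_prod _ ebdd1]
    have e2 : ∫ q : (TT × ℝ) × TT, w (q.1.1 - q.2) * g q.2 q.1.2 * ek k η q.1.1 q.1.2 
        ∂(((volume : Measure TT).prod (volume : Measure ℝ)).prod (volume : Measure TT)) = 
        ∫ q : (TT × ℝ) × TT, g q.1.1 q.1.2 * w (q.2 - q.1.1) * ek k η q.2 q.1.2
        ∂(((volume : Measure TT).prod (volume : Measure ℝ)).prod (volume : Measure TT)) := by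
      conv_rhs => rw [← mp2.map_eq]
      rw [integral_map mp2.measurable.aemeasurable (by rw [mp2.map_eq]; exact ebdd.aestronglyMeasurable)]
      congr 1; ext q
      ring
    rw [e2, integral_prod _ ebdd, ← integral_const_mul]
    congr 1; ext p
    have e3 : ∀ y : TT, g p.1 p.2 * w (y - p.1) * ek k η y p.2 = 
        (g p.1 p.2 * ek k η p.1 p.2) * (w (y - p.1) * fourier (-k) (y - p.1)) := by
      intro y
      have : (fourier (-k) y : ℂ) = fourier (-k) (y - p.1) * fourier (-k) p.1 := by
        simp only [fourier_apply]
        rw [← Circle.coe_mul, ← AddCircle.toCircle_add, ← smul_add, sub_add_cancel]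
      unfold ek
      rw [this]; ring
    simp_rw [e3]
    rw [integral_const_mul, integral_sub_right_eq_self (fun y => w y * fourier (-k) y) p.1, hcc]
    ring
  simp only [AF, Pi.smul_apply, smul_eq_mul]
  rw [e, enorm_mul]
  gcongr
  refine (enorm_integral_le_lintegral_enorm _).trans (le_of_eq ?_)
  congr 1; ext x
  rw [enorm_mul]
  have : ‖(fourier (-k) x : ℂ)‖ = 1 := Circle.norm_coe _
  rw [← ofReal_norm (fourier (-k) x : ℂ), this]
  simp

theorem N2_eq (w₁ w₂ : TT → ℝ) (v : Fin 5 → TT → ℝ → ℂ) :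
    N2 w₁ w₂ v = fun x t => (∫ y, (w₁ (x - y) : ℂ) *
      (((∫ z, (w₂ (y - z) : ℂ) * (v 2 z t * (starRingEnd ℂ) (v 3 z t))) * v 0 y t) *
        (starRingEnd ℂ) (v 1 y t))) * v 4 x t := by
  funext x t
  unfold N2
  rw [← integral_mul_const]
  congr 1
  funext y
  rw [mul_assoc, mul_assoc, ← integral_mul_const, mul_comm, ← integral_mul_const, mul_comm,
    ← integral_const_mul]
  congr 1
  funext z
  ring

theorem AF_meas {v : TT → ℝ → ℂ} (h : Integrable (fun p : TT × ℝ => v p.1 p.2) (volume.prod volume)) :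
    Measurable (AF v) := (FT_meas h).enorm

theorem enorm_w (w : TT → ℝ) : ∫⁻ x, ‖(w x : ℂ)‖ₑ = eLpNorm w 1 volume := by
  rw [eLpNorm_one_eq_lintegral_enorm]
  congr 1
  funext x
  rw [← ofReal_norm, ← ofReal_norm, Complex.norm_real]

theorem AF_N2 (w₁ w₂ : TT → ℝ) (h1 : Integrable w₁) (h2 : Integrable w₂)
    (v : Fin 5 → TT → ℝ → ℂ) (hv : ∀ j, Sm (v j)) :
    AF (N2 w₁ w₂ v) ≤ (eLpNorm w₁ 1 volume * eLpNorm w₂ 1 volume) •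
      (((AF (v 0) ⋆ₗ[nu] rf (AF (v 1))) ⋆ₗ[nu] (AF (v 2) ⋆ₗ[nu] rf (AF (v 3)))) ⋆ₗ[nu] AF (v 4)) := by
  have m : ∀ j, Measurable (AF (v j)) := fun j => AF_meas (hv j).integrable
  rw [N2_eq]
  obtain ⟨i1, b1⟩ := FT_mul_conj (hv 2).integrable (hv 3)
  obtain ⟨i2, b2⟩ := FT_conv (w := fun x => (w₂ x : ℂ)) h2.ofReal (g := fun z t => v 2 z t * (starRingEnd ℂ) (v 3 z t)) i1
  obtain ⟨i3, b3⟩ := FT_mul_sm (g := fun y t => (∫ z, (w₂ (y - z) : ℂ) * (v 2 z t * (starRingEnd ℂ) (v 3 z t)))) i2 (hv 0)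
  obtain ⟨i4, b4⟩ := FT_mul_conj (g := fun y t => (∫ z, (w₂ (y - z) : ℂ) * (v 2 z t * (starRingEnd ℂ) (v 3 z t))) * v 0 y t) i3 (hv 1)
  obtain ⟨i5, b5⟩ := FT_conv (w := fun x => (w₁ x : ℂ)) h1.ofReal
    (g := fun y t => ((∫ z, (w₂ (y - z) : ℂ) * (v 2 z t * (starRingEnd ℂ) (v 3 z t))) * v 0 y t) * (starRingEnd ℂ) (v 1 y t)) i4
  obtain ⟨-, b6⟩ := FT_mul_sm (g := fun x t => ∫ y, (w₁ (x - y) : ℂ) *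
    (((∫ z, (w₂ (y - z) : ℂ) * (v 2 z t * (starRingEnd ℂ) (v 3 z t))) * v 0 y t) * (starRingEnd ℂ) (v 1 y t))) i5 (hv 4)
  rw [enorm_w] at b2 b5
  refine b6.trans ?_
  have c1 := conv_mono (μ := nu) (le_refl (AF (v 0))) (b2.trans (smul_le_smul_of_nonneg_left b1 zero_le))
  have c2 := conv_mono (μ := nu) (le_refl (rf (AF (v 1)))) (b3.trans c1)
  have c3 := conv_mono (μ := nu) (le_refl (AF (v 4)))
    (b5.trans (smul_le_smul_of_nonneg_left (b4.trans c2) zero_le))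
  refine c3.trans (le_of_eq ?_)
  rw [lconvolution_comm, smul_conv _ (by fun_prop) (by fun_prop), mul_smul]
  congr 1
  rw [lconvolution_comm (f := AF (v 0)), smul_conv _ (by fun_prop) (by fun_prop),
    lconvolution_comm (f := rf (AF (v 1))), smul_conv _ (by fun_prop) (by fun_prop),
    smul_conv _ (by fun_prop) (by fun_prop)]
  congr 1
  let a : Fin 5 → MFn (ℤ × ℝ) := fun j => ⟨AF (v j), m j⟩
  let b : Fin 5 → MFn (ℤ × ℝ) := fun j => ⟨rf (AF (v j)), rf_meas (m j)⟩
  have : mc nu (mc nu (mc nu (mc nu (b 3) (a 2)) (a 0)) (b 1)) (a 4) =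
    mc nu (mc nu (mc nu (a 0) (b 1)) (mc nu (a 2) (b 3))) (a 4) := by ac_rfl
  exact congrArg Subtype.val this

theorem Xnorm_sq (s b : ℝ) (v : TT → ℝ → ℂ) :
    (Xnorm s b v) ^ 2 = ∑' k : ℤ, ∫⁻ η : ℝ, (ENNReal.ofReal (ja (η + 2 * Real.pi * (k:ℝ)^2) ^ b) *
      (ENNReal.ofReal (jb k ^ s) * AF v (k, η))) ^ 2 := by
  unfold Xnorm
  rw [sqrt_sq]
  congr 1
  funext k
  congr 1
  funext η
  have p1 := jb_pos k
  have p2 := ja_pos (η + 2 * Real.pi * (k:ℝ)^2)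
  simp only [AF]
  rw [← ofReal_norm, ← ENNReal.ofReal_mul (by positivity),
    ← ENNReal.ofReal_mul (by positivity), ← ENNReal.ofReal_pow (by positivity)]
  congr 1
  change jb k ^ (2 * s) * ja (η + 2 * Real.pi * (k:ℝ)^2) ^ (2 * b) * _ = _
  rw [two_mul s, two_mul b, Real.rpow_add p1, Real.rpow_add p2]
  ring

theorem main_sq (s : ℝ) (hs : 0 < s) (ε : ℝ) (hε : 0 < ε) (hε' : ε ≤ 1/22) (hεs : 48 * ε ≤ s) :
    ∃ K : ℝ≥0∞, K ≠ ∞ ∧ ∀ w₁ w₂ : TT → ℝ, Integrable w₁ → Integrable w₂ →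
    ∀ v : Fin 5 → TT → ℝ → ℂ, (∀ j, Sm (v j)) →
      (Xnorm s (-(1/2) + ε) (N2 w₁ w₂ v)) ^ 2 ≤
        K * (eLpNorm w₁ 1 volume * eLpNorm w₂ 1 volume * ∏ j : Fin 5, Xnorm s (1/2 - ε) (v j)) ^ 2 := by
  obtain ⟨K, hK, H⟩ := fourier_quintic s hs ε hε hε' hεs
  refine ⟨K, hK, fun w₁ w₂ h1 h2 v hv => ?_⟩
  have m : ∀ j, Measurable (AF (v j)) := fun j => AF_meas (hv j).integrable
  have mj : Measurable (fun ξ : ℤ × ℝ => ENNReal.ofReal (ja (ξ.2 + 2 * Real.pi * (ξ.1:ℝ)^2) ^ (1/2 - ε))) := by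
    have : Measurable (fun ξ : ℤ × ℝ => (ξ.1:ℝ)) := (measurable_from_top (f := fun k : ℤ => (k:ℝ))).comp measurable_fst
    have := ja_meas
    fun_prop
  have mb : Measurable (fun ξ : ℤ × ℝ => ENNReal.ofReal (jb ξ.1 ^ s)) :=
    (measurable_from_top (f := fun k : ℤ => ENNReal.ofReal (jb k ^ s))).comp measurable_fst
  let f : Fin 5 → ℤ × ℝ → ℝ≥0∞ := fun j ξ =>
    ENNReal.ofReal (ja (ξ.2 + 2 * Real.pi * (ξ.1:ℝ)^2) ^ (1/2 - ε)) *
      (ENNReal.ofReal (jb ξ.1 ^ s) * AF (v j) ξ)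
  have mf : ∀ j, Measurable (f j) := fun j => mj.mul (mb.mul (m j))
  have hn : ∀ j, ∫⁻ x, f j x ^ 2 ∂nu = Xnorm s (1/2 - ε) (v j) ^ 2 := fun j => by
    rw [lint_nu ((mf j).pow_const 2), Xnorm_sq]
  have hfu : ∀ j, f j * uf (fun k => ENNReal.ofReal (jb k ^ (-s)))
      (fun σ => ENNReal.ofReal (ja σ ^ (-(1/2 - ε)))) = AF (v j) := fun j => by
    funext ξ
    have p1 := jb_pos ξ.1
    have p2 := ja_pos (ξ.2 + 2 * Real.pi * (ξ.1:ℝ)^2)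
    simp only [Pi.mul_apply, f, uf]
    have e1 : ENNReal.ofReal (jb ξ.1 ^ s) * ENNReal.ofReal (jb ξ.1 ^ (-s)) = 1 := by
      rw [← ENNReal.ofReal_mul (by positivity), ← Real.rpow_add p1]; simp
    have e2 : ENNReal.ofReal (ja (ξ.2 + 2 * Real.pi * (ξ.1:ℝ)^2) ^ (1/2 - ε)) *
        ENNReal.ofReal (ja (ξ.2 + 2 * Real.pi * (ξ.1:ℝ)^2) ^ (-(1/2 - ε))) = 1 := by
      rw [← ENNReal.ofReal_mul (by positivity), ← Real.rpow_add p2, add_neg_cancel]; simp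
    calc _ = (ENNReal.ofReal (jb ξ.1 ^ s) * ENNReal.ofReal (jb ξ.1 ^ (-s))) *
          (ENNReal.ofReal (ja (ξ.2 + 2 * Real.pi * (ξ.1:ℝ)^2) ^ (1/2 - ε)) *
        ENNReal.ofReal (ja (ξ.2 + 2 * Real.pi * (ξ.1:ℝ)^2) ^ (-(1/2 - ε)))) * AF (v j) ξ := by ring
      _ = _ := by rw [e1, e2]; simp
  have H1 := H f mf ![false, true, false, true, false] _ _ rfl rfl
  simp only [hfu, hn] at H1
  set M := ((AF (v 0) ⋆ₗ[nu] rf (AF (v 1))) ⋆ₗ[nu] (AF (v 2) ⋆ₗ[nu] rf (AF (v 3)))) ⋆ₗ[nu] AF (v 4) with hM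
  have mM : Measurable M := by rw [hM]; fun_prop
  set w := wf (fun σ => ENNReal.ofReal (ja σ ^ (-(1/2 - ε)))) with hw
  have mw : Measurable w := wf_meas (by have := ja_meas; fun_prop)
  have H2 : ∫⁻ x, (w x * (ENNReal.ofReal (jb x.1 ^ s) * M x)) ^ 2 ∂nu ≤
    K * ∏ j, Xnorm s (1/2 - ε) (v j) ^ 2 := H1
  have hb := AF_N2 w₁ w₂ h1 h2 v hv
  rw [← hM] at hb
  set c := eLpNorm w₁ 1 volume * eLpNorm w₂ 1 volume with hc
  have mI : Measurable (fun x : ℤ × ℝ => (w x * (ENNReal.ofReal (jb x.1 ^ s) * M x)) ^ 2) :=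
    (mw.mul (mb.mul mM)).pow_const 2
  rw [Xnorm_sq]
  calc _ ≤ ∑' k : ℤ, ∫⁻ η : ℝ, c ^ 2 * (w (k, η) * (ENNReal.ofReal (jb k ^ s) * M (k, η))) ^ 2 := by
        refine ENNReal.tsum_le_tsum fun k => lintegral_mono fun η => ?_
        calc _ ≤ (ENNReal.ofReal (ja (η + 2 * Real.pi * (k:ℝ)^2) ^ (-(1/2) + ε)) *
              (ENNReal.ofReal (jb k ^ s) * (c * M (k, η)))) ^ 2 := by
              gcongr
              exact hb (k, η)
          _ = _ := by
              rw [hw]; unfold wf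
              rw [show -(1/2 - ε) = -(1/2) + ε by ring]
              ring
    _ = c ^ 2 * ∫⁻ x, (w x * (ENNReal.ofReal (jb x.1 ^ s) * M x)) ^ 2 ∂nu := by
        rw [lint_nu mI, ← ENNReal.tsum_mul_left]
        congr 1
        funext k
        exact lintegral_const_mul _ (mI.comp (measurable_const.prodMk measurable_id))
    _ ≤ c ^ 2 * (K * ∏ j, Xnorm s (1/2 - ε) (v j) ^ 2) := by gcongr
    _ = _ := by rw [Finset.prod_pow]; ring

/-- **Global-in-time quintic multilinear estimate for `𝒩₂`** (proof of Lemma 2.5):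
for every `s > 0` there is `ε₀ ∈ (0,1/2)` such that for all `ε ∈ (0,ε₀)` there is `C > 0` with
`‖𝒩₂(v₁,…,v₅)‖_{X^{s,−1/2+ε}} ≤ C ‖w₁‖_{L¹} ‖w₂‖_{L¹} ∏_j ‖v_j‖_{X^{s,1/2−ε}}`
for all `w₁, w₂ ∈ L¹(Λ;ℝ)` and all smooth `v_j : Λ × ℝ → ℂ` compactly supported in time. -/
theorem quintic_multilinear_estimate_N2 :
    ∀ s : ℝ, 0 < s → ∃ ε₀ : ℝ, 0 < ε₀ ∧ ε₀ < 1/2 ∧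
    ∀ ε : ℝ, 0 < ε → ε < ε₀ → ∃ C : ℝ, 0 < C ∧
    ∀ w₁ w₂ : AddCircle (1:ℝ) → ℝ, Integrable w₁ → Integrable w₂ →
    ∀ v : Fin 5 → AddCircle (1:ℝ) → ℝ → ℂ,
      (∀ j, ContDiff ℝ (⊤ : ℕ∞) (fun p : ℝ × ℝ => v j ((p.1 : ℝ) : AddCircle (1:ℝ)) p.2)) →
      (∀ j, ∃ R : ℝ, ∀ (x : AddCircle (1:ℝ)) (t : ℝ), R ≤ |t| → v j x t = 0) →
      Xnorm s (-(1/2) + ε) (N2 w₁ w₂ v) ≤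
        ENNReal.ofReal C * eLpNorm w₁ 1 volume * eLpNorm w₂ 1 volume *
          ∏ j : Fin 5, Xnorm s (1/2 - ε) (v j) := by
  intro s hs
  refine ⟨min (s / 48) (1 / 22), by positivity, (min_le_right _ _).trans_lt (by norm_num), ?_⟩
  intro ε hε hlt
  have l1 := hlt.le.trans (min_le_left _ _)
  have l2 := hlt.le.trans (min_le_right _ _)
  obtain ⟨K, hK, H⟩ := main_sq s hs ε hε l2 (by linarith)
  refine ⟨K.toReal + 1, by positivity, fun w₁ w₂ h1 h2 v hv hR => ?_⟩
  have := H w₁ w₂ h1 h2 v (fun j => ⟨hv j, hR j⟩)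
  have hKC : K ≤ ENNReal.ofReal (K.toReal + 1) ^ 2 := by
    rw [← ENNReal.ofReal_pow (by positivity)]
    refine ENNReal.le_ofReal_iff_toReal_le hK (by positivity) |>.2 ?_
    nlinarith [ENNReal.toReal_nonneg (a := K)]
  refine (ENNReal.pow_le_pow_left_iff two_ne_zero).1 (this.trans ?_)
  calc _ ≤ ENNReal.ofReal (K.toReal + 1) ^ 2 * (eLpNorm w₁ 1 volume * eLpNorm w₂ 1 volume *
        ∏ j : Fin 5, Xnorm s (1/2 - ε) (v j)) ^ 2 := by gcongr
    _ = _ := by rw [← mul_pow]; congr 1; ring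

end
end

section
/- (Nonnegativity and symmetry of the kernels of the time-evolved heat semigroup and Green function, Lemma 3.27 in explicit Fourier form.) Fix τ > 0 and κ > 0. Then: (a) for every t > 0 and every θ ∈ ℝ, the series Σ_{k∈ℤ} exp(−t λ_k/τ) cos(2πkθ) converges absolutely and its sum is ≥ 0 (this is the kernel S_{τ,t}(x;y) of e^{−th/τ} evaluated at θ = x − y); (b) for every t ≥ 0 and every θ ∈ ℝ, the series Σ_{k∈ℤ} ( exp(−t λ_k/τ) / (τ(exp(λ_k/τ) − 1)) ) cos(2πkθ) converges absolutely and its sum is ≥ 0 (this is the kernel G_{τ,t}(x;y) of e^{−th/τ}/(τ(e^{h/τ} − 1)) evaluated at θ = x − y). In particular both kernels are real, symmetric, and non-negative. -/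
theorem HasSum.congr_aux {ι : Type*} {f g : ι → ℝ} {a : ℝ} (h : HasSum f a)
    (e : ∀ i, g i = f i) : HasSum g a := by
  have : g = f := funext e
  rwa [this]

theorem HasSum.congr_aux2 {ι : Type*} {f g : ι → ℝ} {a b : ℝ} (h : HasSum f a)
    (e : ∀ i, g i = f i) (e' : b = a) : HasSum g b := by
  rw [e']
  exact h.congr_aux e

theorem heat_aux (τ κ : ℝ) (hτ : 0 < τ) (t : ℝ) (ht : 0 < t) (θ : ℝ) :
    ∃ S : ℝ, 0 ≤ S ∧ HasSum (fun k : ℤ =>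
        Real.exp (-t * (4 * Real.pi ^ 2 * (k:ℝ) ^ 2 + κ) / τ) *
          Real.cos (2 * Real.pi * (k:ℝ) * θ)) S := by
  have hx : 0 < 4 * Real.pi * t / τ := by positivity
  have h := (Complex.hasSum_re (HurwitzZeta.hasSum_int_cosKernel θ hx)).mul_left
    (Real.exp (-t * κ / τ))
  refine ⟨_, ?_, h.congr_aux ?_⟩
  · rw [Complex.ofReal_re]
    refine mul_nonneg (Real.exp_pos _).le ?_
    have he := HurwitzZeta.evenKernel_functional_equation (θ : UnitAddCircle)
      (1 / (4 * Real.pi * t / τ))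
    rw [one_div_one_div] at he
    have hn : 0 ≤ HurwitzZeta.evenKernel (θ : UnitAddCircle) (1 / (4 * Real.pi * t / τ)) :=
      (HurwitzZeta.hasSum_int_evenKernel θ (one_div_pos.mpr hx)).nonneg
        (fun n => (Real.exp_pos _).le)
    rw [he] at hn
    refine nonneg_of_mul_nonneg_right hn ?_
    positivity
  · intro k
    have h1 : Complex.exp (2 * Real.pi * Complex.I * θ * k)
        = Complex.exp (((2 * Real.pi * k * θ : ℝ) : ℂ) * Complex.I) := by
      congr 1; push_cast; ring
    rw [h1, Complex.re_mul_ofReal, Complex.exp_ofReal_mul_I_re, mul_left_comm, ← Real.exp_add,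
      mul_comm]
    congr 2
    field_simp
    ring

theorem green_aux (τ κ : ℝ) (hτ : 0 < τ) (hκ : 0 < κ) (t : ℝ) (ht : 0 ≤ t) (θ : ℝ) :
    ∃ S : ℝ, 0 ≤ S ∧ HasSum (fun k : ℤ =>
        Real.exp (-t * (4 * Real.pi ^ 2 * (k:ℝ) ^ 2 + κ) / τ) /
            (τ * (Real.exp ((4 * Real.pi ^ 2 * (k:ℝ) ^ 2 + κ) / τ) - 1)) *
          Real.cos (2 * Real.pi * (k:ℝ) * θ)) S := by
  let F : ℤ × ℕ → ℝ := fun p =>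
    Real.exp (-(t + 1 + p.2) * (4 * Real.pi ^ 2 * (p.1:ℝ) ^ 2 + κ) / τ) *
          Real.cos (2 * Real.pi * (p.1:ℝ) * θ)
  have hgeo : ∀ x : ℝ, 0 < x → HasSum (fun m : ℕ => Real.exp (-m * x)) (1 - Real.exp (-x))⁻¹ := by
    intro x hx
    refine (hasSum_geometric_of_lt_one (Real.exp_pos (-x)).le
      (by rw [Real.exp_lt_one_iff]; linarith)).congr_aux ?_
    intro m
    rw [← Real.exp_nat_mul]
    congr 1; ring
  have hF : Summable F := by
    obtain ⟨_, _, h0⟩ := heat_aux τ κ hτ (t + 1) (by positivity) 0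
    simp only [mul_zero, Real.cos_zero, mul_one] at h0
    have hm := h0.summable.mul_of_nonneg (hgeo (κ / τ) (by positivity)).summable
      (fun k => (Real.exp_pos _).le) (fun k => (Real.exp_pos _).le)
    refine Summable.of_norm_bounded hm ?_
    rintro ⟨k, m⟩
    simp only [F]
    rw [norm_mul, Real.norm_eq_abs, Real.norm_eq_abs, Real.abs_exp, ← Real.exp_add]
    refine (mul_le_of_le_one_right (Real.exp_pos _).le (Real.abs_cos_le_one _)).trans ?_
    rw [Real.exp_le_exp]
    have : (0:ℝ) ≤ m * (4 * Real.pi ^ 2 * (k:ℝ) ^ 2) / τ := by positivity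
    have e : -(t + 1) * (4 * Real.pi ^ 2 * (k:ℝ) ^ 2 + κ) / τ + -(m:ℝ) * (κ / τ)
      - -(t + 1 + m) * (4 * Real.pi ^ 2 * (k:ℝ) ^ 2 + κ) / τ
       = m * (4 * Real.pi ^ 2 * (k:ℝ) ^ 2) / τ := by ring
    linarith
  have hk : ∀ k : ℤ, HasSum (fun m : ℕ => F (k, m))
      (τ * (Real.exp (-t * (4 * Real.pi ^ 2 * (k:ℝ) ^ 2 + κ) / τ) /
            (τ * (Real.exp ((4 * Real.pi ^ 2 * (k:ℝ) ^ 2 + κ) / τ) - 1)) *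
          Real.cos (2 * Real.pi * (k:ℝ) * θ))) := by
    intro k
    have hx : 0 < (4 * Real.pi ^ 2 * (k:ℝ) ^ 2 + κ) / τ := by positivity
    have h := ((hgeo _ hx).mul_left
      (Real.exp (-(t+1) * (4 * Real.pi ^ 2 * (k:ℝ) ^ 2 + κ) / τ))).mul_right
      (Real.cos (2 * Real.pi * (k:ℝ) * θ))
    refine HasSum.congr_aux2 h ?_ ?_
    · intro m
      simp only [F]
      rw [← Real.exp_add]
      congr 2
      ring
    · have h1 : Real.exp (-(t+1) * (4 * Real.pi ^ 2 * (k:ℝ) ^ 2 + κ) / τ)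
        = Real.exp (-t * (4 * Real.pi ^ 2 * (k:ℝ) ^ 2 + κ) / τ) *
          (Real.exp ((4 * Real.pi ^ 2 * (k:ℝ) ^ 2 + κ) / τ))⁻¹ := by
        rw [← Real.exp_neg, ← Real.exp_add]
        congr 1; ring
      rw [h1, Real.exp_neg]
      have h2 : 1 < Real.exp ((4 * Real.pi ^ 2 * (k:ℝ) ^ 2 + κ) / τ) := Real.one_lt_exp_iff.mpr hx
      generalize Real.exp ((4 * Real.pi ^ 2 * (k:ℝ) ^ 2 + κ) / τ) = y at *
      have h3 : y - 1 ≠ 0 := by linarith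
      have h4 : y ≠ 0 := by linarith
      have h5 : 1 - y⁻¹ ≠ 0 := by
        have : 1 - y⁻¹ = (y - 1) / y := by field_simp
        rw [this]; exact div_ne_zero h3 h4
      have h6 : (1 - y⁻¹)⁻¹ = y / (y - 1) := by
        rw [inv_eq_iff_eq_inv, inv_div]; field_simp
      rw [h6]
      field_simp
  have hS := hF.hasSum.prod_fiberwise hk
  have hn : 0 ≤ ∑' p, F p := by
    have hs : Summable (fun p : ℕ × ℤ => F p.swap) := hF.prod_symm
    have e : ∑' p : ℕ × ℤ, F p.swap = ∑' p, F p := (Equiv.prodComm ℕ ℤ).tsum_eq F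
    rw [← e, hs.tsum_prod]
    refine tsum_nonneg fun m => ?_
    obtain ⟨S, h0, h1⟩ := heat_aux τ κ hτ (t + 1 + m) (by positivity) θ
    exact h0.trans_eq h1.tsum_eq.symm
  refine ⟨τ⁻¹ * ∑' p, F p, by positivity, (hS.mul_left τ⁻¹).congr_aux ?_⟩
  intro k
  rw [inv_mul_cancel_left₀ hτ.ne']


/-- **Nonnegativity (and absolute convergence) of the kernels of the time-evolved heat
semigroup and Green function** (Lemma 3.27, explicit Fourier form).  With `λ_k = 4π²k² + κ`:
(a) for `t > 0` the kernel `S_{τ,t}(θ) = Σ_k e^{−tλ_k/τ} cos(2πkθ)` of `e^{−th/τ}` converges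
absolutely and is `≥ 0`; (b) for `t ≥ 0` the kernel
`G_{τ,t}(θ) = Σ_k e^{−tλ_k/τ}/(τ(e^{λ_k/τ} − 1)) · cos(2πkθ)` of `e^{−th/τ}/(τ(e^{h/τ} − 1))`
converges absolutely and is `≥ 0`. -/
theorem heat_and_green_kernels_nonneg (τ κ : ℝ) (hτ : 0 < τ) (hκ : 0 < κ) :
    (∀ t : ℝ, 0 < t → ∀ θ : ℝ,
      Summable (fun k : ℤ =>
        |Real.exp (-t * (4 * Real.pi ^ 2 * (k:ℝ) ^ 2 + κ) / τ) *
          Real.cos (2 * Real.pi * (k:ℝ) * θ)|) ∧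
      0 ≤ ∑' k : ℤ,
        Real.exp (-t * (4 * Real.pi ^ 2 * (k:ℝ) ^ 2 + κ) / τ) *
          Real.cos (2 * Real.pi * (k:ℝ) * θ)) ∧
    (∀ t : ℝ, 0 ≤ t → ∀ θ : ℝ,
      Summable (fun k : ℤ =>
        |Real.exp (-t * (4 * Real.pi ^ 2 * (k:ℝ) ^ 2 + κ) / τ) /
            (τ * (Real.exp ((4 * Real.pi ^ 2 * (k:ℝ) ^ 2 + κ) / τ) - 1)) *
          Real.cos (2 * Real.pi * (k:ℝ) * θ)|) ∧
      0 ≤ ∑' k : ℤ,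
        Real.exp (-t * (4 * Real.pi ^ 2 * (k:ℝ) ^ 2 + κ) / τ) /
            (τ * (Real.exp ((4 * Real.pi ^ 2 * (k:ℝ) ^ 2 + κ) / τ) - 1)) *
          Real.cos (2 * Real.pi * (k:ℝ) * θ)) := by
  refine ⟨fun t ht θ => ?_, fun t ht θ => ?_⟩
  · obtain ⟨S, h0, h1⟩ := heat_aux τ κ hτ t ht θ
    exact ⟨h1.summable.abs, h0.trans_eq h1.tsum_eq.symm⟩
  · obtain ⟨S, h0, h1⟩ := green_aux τ κ hτ hκ t ht θ
    exact ⟨h1.summable.abs, h0.trans_eq h1.tsum_eq.symm⟩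
end

section
/- (Constrained six-fold Fourier sum bound, equation (J) in the proof of Lemma 4.2.) There exists a constant C > 0 such that for every function a : ℤ → [0,∞], computing all sums in the extended nonnegative reals [0,∞], Σ_{(k₁,k₂,k₃,k₄,k₅) ∈ ℤ⁵} a(k₁) a(k₂) a(k₃) a(k₄) a(k₅) a(k₁ − k₂ + k₃ − k₄ + k₅) ≤ C ( Σ_{k∈ℤ} (1+|k|)^{2/3} a(k)² )³. (Equivalently: the sum of a(k₁)a(k₂)a(k₃)a(k₄)a(k₅)a(k₆) over all (k₁,…,k₆) ∈ ℤ⁶ with k₁ − k₂ + k₃ − k₄ + k₅ − k₆ = 0 is bounded by C times the cube of the squared H^{1/3}-type weighted ℓ² norm of a.) -/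
open scoped ENNReal

namespace SixAux

lemma real_step (x : ℝ) (hx : 0 < x) :
    2 * ((x + 1) ^ ((1:ℝ)/3))⁻¹ ^ 2 + 6 * x ^ ((1:ℝ)/3) ≤ 6 * (x + 1) ^ ((1:ℝ)/3) := by
  set u := (x + 1) ^ ((1:ℝ)/3) with hu
  set v := x ^ ((1:ℝ)/3) with hv
  have hu0 : 0 < u := by positivity
  have hv0 : 0 < v := by positivity
  have huv : v ≤ u := Real.rpow_le_rpow hx.le (by linarith) (by norm_num)
  have hu3 : u ^ 3 = x + 1 := by
    rw [hu, ← Real.rpow_natCast, ← Real.rpow_mul (by linarith)]; norm_num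
  have hv3 : v ^ 3 = x := by
    rw [hv, ← Real.rpow_natCast, ← Real.rpow_mul (by linarith)]; norm_num
  have key : 2 + 6 * v * u ^ 2 ≤ 6 * u ^ 3 := by
    nlinarith [mul_nonneg (sub_nonneg.2 huv) (sub_nonneg.2 huv),
      mul_nonneg (mul_nonneg (sub_nonneg.2 huv) (sub_nonneg.2 huv)) hu0.le,
      mul_nonneg (mul_nonneg (sub_nonneg.2 huv) (sub_nonneg.2 huv)) hv0.le]
  rw [inv_pow]
  have : 2 * (u ^ 2)⁻¹ + 6 * v = (2 + 6 * v * u ^ 2) / u ^ 2 := by field_simp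
  rw [this, div_le_iff₀ (by positivity)]
  nlinarith

lemma real_sum (n : ℕ) :
    ∑ y ∈ Finset.Icc (-(n:ℤ)) n, ((1 + |(y:ℝ)|) ^ ((1:ℝ)/3))⁻¹ ^ 2
      ≤ 6 * (1 + (n:ℝ)) ^ ((1:ℝ)/3) := by
  induction n with
  | zero => norm_num
  | succ n ih =>
    have hI : Finset.Icc (-((n+1:ℕ):ℤ)) ((n+1:ℕ):ℤ)
        = insert (-((n:ℤ)+1)) (insert ((n:ℤ)+1) (Finset.Icc (-(n:ℤ)) n)) := by
      ext y; simp only [Finset.mem_Icc, Finset.mem_insert]; push_cast; omega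
    rw [hI, Finset.sum_insert, Finset.sum_insert]
    · have h := real_step (1 + (n:ℝ)) (by positivity)
      have e : |(n:ℝ) + 1| = n + 1 := abs_of_nonneg (by positivity)
      have e2 : |-1 + -(n:ℝ)| = n + 1 := by rw [← e, ← abs_neg]; ring_nf
      push_cast
      rw [abs_neg, e]
      have e3 : 1 + ((n:ℝ) + 1) = 1 + n + 1 := by ring
      rw [e3]
      linarith
    · simp
    · simp only [Finset.mem_Icc, Finset.mem_insert]; omega

/-- the weight -/
noncomputable def V (k : ℤ) : ℝ≥0∞ := ENNReal.ofReal ((1 + |(k:ℝ)|) ^ ((1:ℝ)/3))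

lemma V_sq (k : ℤ) : V k ^ 2 = ENNReal.ofReal ((1 + |(k:ℝ)|) ^ ((2:ℝ)/3)) := by
  unfold V
  rw [← ENNReal.ofReal_pow (by positivity), ← Real.rpow_natCast, ← Real.rpow_mul (by positivity)]
  norm_num

lemma V_ne (k : ℤ) : V k ≠ 0 := by
  unfold V
  simp only [ne_eq, ENNReal.ofReal_eq_zero, not_le]; positivity

lemma V_top (k : ℤ) : V k ≠ ⊤ := ENNReal.ofReal_ne_top

lemma V_sum (x : ℤ) : ∑ y ∈ Finset.Icc (-|x|) |x|, (V y)⁻¹ ^ 2 ≤ 6 * V x := by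
  have h := real_sum x.natAbs
  have e : ((x.natAbs : ℕ) : ℤ) = |x| := Int.natCast_natAbs x
  have e' : ((x.natAbs : ℕ) : ℝ) = |(x:ℝ)| := by
    rw [← Int.cast_natCast, e, Int.cast_abs]
  rw [e, e'] at h
  have h2 := ENNReal.ofReal_le_ofReal h
  rw [ENNReal.ofReal_sum_of_nonneg (fun _ _ => by positivity),
    ENNReal.ofReal_mul (by norm_num)] at h2
  calc _ = ∑ y ∈ Finset.Icc (-|x|) |x|,
        ENNReal.ofReal (((1 + |(y:ℝ)|) ^ ((1:ℝ)/3))⁻¹ ^ 2) := by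
        refine Finset.sum_congr rfl fun y _ => ?_
        unfold V
        rw [ENNReal.ofReal_pow (by positivity), ENNReal.ofReal_inv_of_pos (by positivity)]
    _ ≤ _ := h2
    _ = _ := by unfold V; norm_num

/-- truncated sequence -/
noncomputable def c (a : ℤ → ℝ≥0∞) (x y : ℤ) : ℝ≥0∞ := if |y| ≤ |x| then a y else 0

/-- norm squared -/
noncomputable def A (a : ℤ → ℝ≥0∞) : ℝ≥0∞ := ∑' k : ℤ, V k ^ 2 * a k ^ 2

lemma S_sq (a : ℤ → ℝ≥0∞) (x : ℤ) : (∑' y, c a x y) ^ 2 ≤ 6 * V x * A a := by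
  have e : ∑' y, c a x y = ∑ y ∈ Finset.Icc (-|x|) |x|, (V y * a y) * (V y)⁻¹ := by
    rw [tsum_eq_sum (s := Finset.Icc (-|x|) |x|)]
    · refine Finset.sum_congr rfl fun y hy => ?_
      rw [Finset.mem_Icc, ← abs_le] at hy
      rw [c, if_pos hy, mul_comm, ← mul_assoc, ENNReal.inv_mul_cancel (V_ne y) (V_top y), one_mul]
    · intro y hy
      rw [Finset.mem_Icc, ← abs_le] at hy
      rw [c, if_neg hy]
  have h := ENNReal.inner_le_Lp_mul_Lq (Finset.Icc (-|x|) |x|) (fun y => V y * a y)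
    (fun y => (V y)⁻¹) (p := 2) (q := 2) Real.HolderConjugate.two_two
  rw [e]
  have h' := pow_le_pow_left' h 2
  refine h'.trans ?_
  rw [mul_pow, ← ENNReal.rpow_natCast, ← ENNReal.rpow_natCast, ← ENNReal.rpow_mul,
    ← ENNReal.rpow_mul]
  norm_num
  rw [mul_comm (6 * V x)]
  refine mul_le_mul' ?_ ?_
  · simp only [mul_pow]
    exact ENNReal.sum_le_tsum _
  · simpa [ENNReal.inv_pow] using V_sum x

/-- model summand -/
noncomputable def G (a : ℤ → ℝ≥0∞) (q : ℤ × ℤ × ℤ × ℤ × ℤ) : ℝ≥0∞ :=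
  a q.1 ^ 2 * (c a q.1 q.2.1 * (c a q.1 q.2.2.1 * (c a q.1 q.2.2.2.1 * c a q.1 q.2.2.2.2)))

lemma G_sum (a : ℤ → ℝ≥0∞) : ∑' q, G a q ≤ 36 * A a ^ 3 := by
  have : ∑' q, G a q = ∑' x, a x ^ 2 * ((∑' y, c a x y) ^ 2) ^ 2 := by
    unfold G
    simp only [ENNReal.tsum_prod', ENNReal.tsum_mul_left, ENNReal.tsum_mul_right]
    refine tsum_congr fun x => ?_
    ring
  rw [this]
  calc _ ≤ ∑' x, 36 * A a ^ 2 * (V x ^ 2 * a x ^ 2) := by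
        refine ENNReal.tsum_le_tsum fun x => ?_
        calc _ ≤ a x ^ 2 * (6 * V x * A a) ^ 2 := by
              gcongr; exact S_sq a x
          _ = _ := by ring
    _ = _ := by rw [ENNReal.tsum_mul_left, ← A]; ring

/-- the six frequencies -/
def K (p : ℤ × ℤ × ℤ × ℤ × ℤ) : Fin 6 → ℤ :=
  ![p.1, p.2.1, p.2.2.1, p.2.2.2.1, p.2.2.2.2, p.1 - p.2.1 + p.2.2.1 - p.2.2.2.1 + p.2.2.2.2]

/-- selecting five of the frequencies -/
def E (σ : Equiv.Perm (Fin 6)) (p : ℤ × ℤ × ℤ × ℤ × ℤ) : ℤ × ℤ × ℤ × ℤ × ℤ :=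
  (K p (σ 0), K p (σ 1), K p (σ 2), K p (σ 3), K p (σ 4))

lemma E_inj (σ : Equiv.Perm (Fin 6)) : Function.Injective (E σ) := by
  intro p q h
  have h1 : ∀ i, i ≠ σ 5 → K p i = K q i := by
    intro i hi
    obtain ⟨j, rfl⟩ := σ.surjective i
    simp only [E, Prod.mk.injEq] at h
    obtain ⟨h0, h1, h2, h3, h4⟩ := h
    fin_cases j
    · exact h0
    · exact h1
    · exact h2
    · exact h3
    · exact h4
    · exact absurd rfl hi
  obtain ⟨p1, p2, p3, p4, p5⟩ := p
  obtain ⟨q1, q2, q3, q4, q5⟩ := q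
  generalize σ 5 = s at h1
  have g0 := h1 0
  have g1 := h1 1
  have g2 := h1 2
  have g3 := h1 3
  have g4 := h1 4
  have g5 := h1 5
  simp only [K, Prod.mk.injEq] at *
  fin_cases s <;> simp at g0 g1 g2 g3 g4 g5 <;> refine ⟨?_, ?_, ?_, ?_, ?_⟩ <;> omega

lemma pointwise (a : ℤ → ℝ≥0∞) (p : ℤ × ℤ × ℤ × ℤ × ℤ) :
    ∃ σ : Equiv.Perm (Fin 6), ∏ i, a (K p i) ≤ G a (E σ p) := by
  set f : Fin 6 → ℤ := fun i => -|K p i| with hf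
  set τ := Tuple.sort f
  have hm : Monotone (f ∘ τ) := Tuple.monotone_sort f
  have hle : ∀ i j, i ≤ j → |K p (τ j)| ≤ |K p (τ i)| := by
    intro i j hij
    have := hm hij
    simp only [hf, Function.comp] at this
    omega
  have hprod : ∏ i, a (K p i) = ∏ i, a (K p (τ i)) := (Equiv.prod_comp τ (fun i => a (K p i))).symm
  rw [hprod, Fin.prod_univ_six]
  rcases le_total (a (K p (τ 0))) (a (K p (τ 1))) with h | h
  · let ρ : Equiv.Perm (Fin 6) := ⟨![1,2,3,4,5,0], ![5,0,1,2,3,4], by decide, by decide⟩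
    refine ⟨ρ.trans τ, ?_⟩
    have r : E (ρ.trans τ) p = (K p (τ 1), K p (τ 2), K p (τ 3), K p (τ 4), K p (τ 5)) := rfl
    rw [r]
    simp only [G, c]
    rw [if_pos (hle 1 2 (by decide)), if_pos (hle 1 3 (by decide)),
      if_pos (hle 1 4 (by decide)), if_pos (hle 1 5 (by decide))]
    calc _ ≤ a (K p (τ 1)) * a (K p (τ 1)) * a (K p (τ 2)) * a (K p (τ 3)) * a (K p (τ 4))
          * a (K p (τ 5)) := by gcongr
      _ = _ := by ring
  · let ρ : Equiv.Perm (Fin 6) := ⟨![0,2,3,4,5,1], ![0,5,1,2,3,4], by decide, by decide⟩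
    refine ⟨ρ.trans τ, ?_⟩
    have r : E (ρ.trans τ) p = (K p (τ 0), K p (τ 2), K p (τ 3), K p (τ 4), K p (τ 5)) := rfl
    rw [r]
    simp only [G, c]
    rw [if_pos (hle 0 2 (by decide)), if_pos (hle 0 3 (by decide)),
      if_pos (hle 0 4 (by decide)), if_pos (hle 0 5 (by decide))]
    calc _ ≤ a (K p (τ 0)) * a (K p (τ 0)) * a (K p (τ 2)) * a (K p (τ 3)) * a (K p (τ 4))
          * a (K p (τ 5)) := by gcongr
      _ = _ := by ring

end SixAux

open SixAux in
/-- **Constrained six-fold Fourier sum bound** (equation (J), proof of Lemma 4.2).  There is a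
constant `C > 0` such that for every `a : ℤ → [0,∞]`, computing all sums in `ℝ≥0∞`,
`Σ_{k₁,…,k₅} a(k₁)a(k₂)a(k₃)a(k₄)a(k₅) a(k₁−k₂+k₃−k₄+k₅)
  ≤ C (Σ_k (1+|k|)^{2/3} a(k)²)³`. -/
theorem sixfold_fourier_sum_bound :
    ∃ C : ℝ, 0 < C ∧ ∀ a : ℤ → ℝ≥0∞,
      (∑' p : ℤ × ℤ × ℤ × ℤ × ℤ,
          a p.1 * a p.2.1 * a p.2.2.1 * a p.2.2.2.1 * a p.2.2.2.2 *
            a (p.1 - p.2.1 + p.2.2.1 - p.2.2.2.1 + p.2.2.2.2)) ≤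
        ENNReal.ofReal C *
          (∑' k : ℤ, ENNReal.ofReal ((1 + |(k:ℝ)|) ^ ((2:ℝ)/3)) * a k ^ 2) ^ (3:ℕ) := by
  refine ⟨720 * 36, by norm_num, fun a => ?_⟩
  have hA : (∑' k : ℤ, ENNReal.ofReal ((1 + |(k:ℝ)|) ^ ((2:ℝ)/3)) * a k ^ 2) = A a := by
    unfold A
    exact tsum_congr fun k => by rw [V_sq]
  rw [hA]
  calc _ ≤ ∑' p, ∑ σ : Equiv.Perm (Fin 6), G a (E σ p) := by
        refine ENNReal.tsum_le_tsum fun p => ?_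
        obtain ⟨σ, hσ⟩ := pointwise a p
        rw [Fin.prod_univ_six] at hσ
        exact le_trans hσ (Finset.single_le_sum (f := fun σ => G a (E σ p))
          (fun _ _ => zero_le) (Finset.mem_univ σ))
    _ = ∑ σ : Equiv.Perm (Fin 6), ∑' p, G a (E σ p) :=
        Summable.tsum_finsetSum fun _ _ => ENNReal.summable
    _ ≤ ∑ σ : Equiv.Perm (Fin 6), 36 * A a ^ 3 :=
        Finset.sum_le_sum fun σ _ =>
          (ENNReal.tsum_comp_le_tsum_of_injective (E_inj σ) (G a)).trans (G_sum a)
    _ = _ := by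
        rw [Finset.sum_const, Finset.card_univ, Fintype.card_perm, Fintype.card_fin, nsmul_eq_mul,
          ENNReal.ofReal_mul (by norm_num), mul_assoc]
        norm_num [Nat.factorial]
end
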